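/- arXiv:1302.2297 — 2 statements merged into one kernel-verified Lean document; each statement's English description precedes it below -/
import Mathlib

section
/- Let f = (f₀ : ⋯ : fₙ) and g = (g₀ : ⋯ : gₙ) be reduced representations of meromorphic mappings of ℂ^m into ℙⁿ(ℂ), and let H₁,…,H_{2n+1} be hyperplanes of ℙⁿ(ℂ) in general position with coefficient vectors x₁,…,x_{2n+1}. Suppose there exist constants A_I ∈ ℂ, indexed by the n-element subsets I ∈ 𝓘 of {1,…,2n+1} and not all zero, such that Σ_{I∈𝓘} A_I (∏_{i∈I} (f,H_i)) (∏_{i∈I^c} (g,H_i)) ≡ 0 on ℂ^m (this identity is the paper's hypothesis Σ_{I∈𝓘} A_I h_I ≡ 0, where h_i = ((f,H_i)/f₀)/((g,H_i)/g₀) and h_I = ∏_{i∈I} h_i, after clearing denominators). Then the map f×g : ℂ^m → ℙⁿ(ℂ)×ℙⁿ(ℂ) is algebraically degenerate. (Proposition 2.2.) -/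
noncomputable section

/-- `f` is a reduced representation of a meromorphic map `ℂ^m → ℙⁿ(ℂ)`:
the components are holomorphic, not all identically zero, and their common
zero set has codimension at least two, expressed as the non-existence of a
common holomorphic factor vanishing somewhere. -/
def ReducedReprM (m n : ℕ) (f : Fin (n + 1) → (Fin m → ℂ) → ℂ) : Prop :=
  (∀ i, Differentiable ℂ (f i)) ∧ (∃ z i, f i z ≠ 0) ∧
  ¬∃ φ : (Fin m → ℂ) → ℂ, Differentiable ℂ φ ∧ (∃ z, φ z = 0) ∧
      ∀ i, ∃ ψ : (Fin m → ℂ) → ℂ, Differentiable ℂ ψ ∧ ∀ z, f i z = φ z * ψ z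

/-- The holomorphic function `(f, H) = a₀f₀ + ⋯ + aₙfₙ` attached to the
hyperplane with coefficient vector `a`. -/
def lformM {m n : ℕ} (a : Fin (n + 1) → ℂ) (f : Fin (n + 1) → (Fin m → ℂ) → ℂ)
    (z : Fin m → ℂ) : ℂ :=
  ∑ i, a i * f i z

/-- The hyperplanes with coefficient vectors `H 0, …, H (q-1)` are in general
position: any `n + 1` of the coefficient vectors are linearly independent. -/
def GenPos (n q : ℕ) (H : Fin q → Fin (n + 1) → ℂ) : Prop :=
  ∀ s : Finset (Fin q), s.card = n + 1 → LinearIndependent ℂ (fun i : s => H i.1)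

/-- The map `f × g : ℂ^m → ℙⁿ(ℂ) × ℙⁿ(ℂ)` is algebraically degenerate: a
nonzero polynomial `Q(v, w)`, homogeneous in `v` and in `w` separately,
annihilates `(f₀, …, fₙ, g₀, …, gₙ)`. -/
def AlgDegM {m n : ℕ} (f g : Fin (n + 1) → (Fin m → ℂ) → ℂ) : Prop :=
  ∃ Q : MvPolynomial (Fin (n + 1) ⊕ Fin (n + 1)) ℂ, Q ≠ 0 ∧
    (∃ d₁ : ℕ, MvPolynomial.IsWeightedHomogeneous (Sum.elim (fun _ => 1) (fun _ => 0)) Q d₁) ∧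
    (∃ d₂ : ℕ, MvPolynomial.IsWeightedHomogeneous (Sum.elim (fun _ => 0) (fun _ => 1)) Q d₂) ∧
    ∀ z : Fin m → ℂ, MvPolynomial.eval (Sum.elim (fun i => f i z) (fun i => g i z)) Q = 0

open MvPolynomial in
/-- The linear form with coefficients `a` in the variables `X (ι 0), …, X (ι n)`. -/
def linFormPoly {n : ℕ} {σ : Type} (ι : Fin (n + 1) → σ) (a : Fin (n + 1) → ℂ) :
    MvPolynomial σ ℂ :=
  ∑ k, C (a k) * X (ι k)

open MvPolynomial in
lemma eval_linFormPoly {n : ℕ} {σ : Type} (ι : Fin (n + 1) → σ) (a : Fin (n + 1) → ℂ)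
    (u : σ → ℂ) : eval u (linFormPoly ι a) = ∑ k, a k * u (ι k) := by
  simp [linFormPoly]

open MvPolynomial in
lemma isWeightedHomogeneous_linFormPoly {n : ℕ} {σ : Type} (ι : Fin (n + 1) → σ)
    (a : Fin (n + 1) → ℂ) (w : σ → ℕ) (d : ℕ) (h : ∀ k, w (ι k) = d) :
    IsWeightedHomogeneous w (linFormPoly ι a) d := by
  refine IsWeightedHomogeneous.sum _ _ _ fun k _ => ?_
  have := (isWeightedHomogeneous_C w (a k)).mul (isWeightedHomogeneous_X ℂ w (ι k))
  rwa [zero_add, h k] at this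

open MvPolynomial in
lemma isWeightedHomogeneous_prod_mul_prod {n q d e : ℕ} (w : Fin (n + 1) ⊕ Fin (n + 1) → ℕ)
    (hl : ∀ k, w (Sum.inl k) = d) (hr : ∀ k, w (Sum.inr k) = e)
    (x : Fin q → Fin (n + 1) → ℂ) (A : Finset (Fin q) → ℂ) (r : ℕ) :
    IsWeightedHomogeneous w
      (∑ I ∈ Finset.powersetCard r (Finset.univ : Finset (Fin q)),
        C (A I) * ((∏ i ∈ I, linFormPoly Sum.inl (x i)) * ∏ i ∈ Iᶜ, linFormPoly Sum.inr (x i)))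
      (r * d + (q - r) * e) := by
  refine IsWeightedHomogeneous.sum _ _ _ fun I hI => ?_
  have hc : I.card = r := (Finset.mem_powersetCard.1 hI).2
  have h₁ := IsWeightedHomogeneous.prod I (fun i => linFormPoly Sum.inl (x i)) (fun _ => d)
    fun i _ => isWeightedHomogeneous_linFormPoly Sum.inl (x i) w d hl
  have h₂ := IsWeightedHomogeneous.prod Iᶜ (fun i => linFormPoly Sum.inr (x i)) (fun _ => e)
    fun i _ => isWeightedHomogeneous_linFormPoly Sum.inr (x i) w e hr
  have := (isWeightedHomogeneous_C w (A I)).mul (h₁.mul h₂)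
  simpa [hc, Finset.card_compl] using this

namespace GenPos

variable {n q : ℕ} {x : Fin q → Fin (n + 1) → ℂ}

lemma exists_isUnit_matrix (h : GenPos n q x) {s : Finset (Fin q)} (hs : s.card = n + 1) :
    ∃ e : Fin (n + 1) ≃ s, IsUnit (Matrix.of fun i => x (e i)) := by
  let e : Fin (n + 1) ≃ s := (Fintype.equivFinOfCardEq (by simpa using hs)).symm
  exact ⟨e, Matrix.linearIndependent_rows_iff_isUnit.1 ((h s hs).comp e e.injective)⟩

lemma exists_eval_eq (h : GenPos n q x) {s : Finset (Fin q)} (hs : s.card = n + 1)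
    (b : Fin q → ℂ) : ∃ v : Fin (n + 1) → ℂ, ∀ i ∈ s, ∑ k, x i k * v k = b i := by
  obtain ⟨e, he⟩ := h.exists_isUnit_matrix hs
  obtain ⟨v, hv⟩ := Matrix.mulVec_surjective_iff_isUnit.2 he fun i => b (e i)
  refine ⟨v, fun i hi => ?_⟩
  simpa [Matrix.mulVec, dotProduct] using congrFun hv (e.symm ⟨i, hi⟩)

lemma eq_zero_of_eval_eq_zero (h : GenPos n q x) {s : Finset (Fin q)} (hs : s.card = n + 1)
    {v : Fin (n + 1) → ℂ} (hv : ∀ i ∈ s, ∑ k, x i k * v k = 0) : v = 0 := by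
  obtain ⟨e, he⟩ := h.exists_isUnit_matrix hs
  refine Matrix.mulVec_injective_iff_isUnit.2 he ?_
  ext i
  simpa [Matrix.mulVec, dotProduct] using hv (e i) (e i).2

/-- Given `n` of the hyperplanes, some point lies on exactly these. -/
lemma exists_eval_eq_zero_iff (h : GenPos n q x) {I : Finset (Fin q)} (hI : I.card = n)
    (hq : n < q) : ∃ w : Fin (n + 1) → ℂ, ∀ i, ∑ k, x i k * w k = 0 ↔ i ∈ I := by
  obtain ⟨j, hj⟩ : ∃ j, j ∉ I := by
    by_contra! hall
    have := Finset.card_eq_iff_eq_univ I |>.2 (Finset.eq_univ_iff_forall.2 hall)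
    simp at this
    omega
  have hcard : ∀ i ∉ I, (insert i I).card = n + 1 := fun i hi => by
    rw [Finset.card_insert_of_notMem hi, hI]
  obtain ⟨w, hw⟩ := h.exists_eval_eq (hcard j hj) (Pi.single j 1)
  have hwI : ∀ i ∈ I, ∑ k, x i k * w k = 0 := fun i hi => by
    rw [hw i (Finset.mem_insert_of_mem hi), Pi.single_eq_of_ne (ne_of_mem_of_not_mem hi hj)]
  refine ⟨w, fun i => ⟨fun h0 => ?_, hwI i⟩⟩
  by_contra hi
  have hw0 : w = 0 := h.eq_zero_of_eval_eq_zero (hcard i hi) fun l hl => by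
    rcases Finset.mem_insert.1 hl with rfl | hl
    exacts [h0, hwI l hl]
  simpa [hw0] using hw j (Finset.mem_insert_self j I)

end GenPos

/-- **Proposition 2.2.** If the products `h_I = ∏_{i∈I}(f,H_i) ∏_{i∈Iᶜ}(g,H_i)`
over the `n`-element subsets `I` of `{1, …, 2n+1}` satisfy a nontrivial linear
relation with constant coefficients, then `f × g` is algebraically degenerate. -/
theorem prop_2_2
    (m n : ℕ)
    (f g : Fin (n + 1) → (Fin m → ℂ) → ℂ)
    (hf : ReducedReprM m n f) (hg : ReducedReprM m n g)
    (x : Fin (2 * n + 1) → Fin (n + 1) → ℂ)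
    (hGP : GenPos n (2 * n + 1) x)
    (A : Finset (Fin (2 * n + 1)) → ℂ)
    (hA : ∃ I ∈ Finset.powersetCard n (Finset.univ : Finset (Fin (2 * n + 1))), A I ≠ 0)
    (hrel : ∀ z : Fin m → ℂ,
      ∑ I ∈ Finset.powersetCard n (Finset.univ : Finset (Fin (2 * n + 1))),
        A I * ((∏ i ∈ I, lformM (x i) f z) * ∏ i ∈ Iᶜ, lformM (x i) g z) = 0) :
    AlgDegM f g := by
  refine ⟨_, ?_,
    ⟨_, isWeightedHomogeneous_prod_mul_prod _ (fun _ => rfl) (fun _ => rfl) x A n⟩,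
    ⟨_, isWeightedHomogeneous_prod_mul_prod _ (fun _ => rfl) (fun _ => rfl) x A n⟩,
    fun z => ?_⟩
  · obtain ⟨I, hI, hAI⟩ := hA
    have hIn : I.card = n := (Finset.mem_powersetCard.1 hI).2
    obtain ⟨w, hw⟩ := hGP.exists_eval_eq_zero_iff hIn (by omega)
    obtain ⟨s, hIs, -, hs⟩ := Finset.exists_subsuperset_card_eq (n := n + 1) (Finset.subset_univ I)
      (by omega) (by simp; omega)
    obtain ⟨v, hv⟩ := hGP.exists_eval_eq hs 1
    intro h0
    have h1 := congrArg (MvPolynomial.eval (Sum.elim v w)) h0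
    simp only [map_sum, map_mul, map_prod, MvPolynomial.eval_C, eval_linFormPoly, Sum.elim_inl,
      Sum.elim_inr, map_zero] at h1
    rw [Finset.sum_eq_single_of_mem I hI] at h1
    · refine mul_ne_zero hAI (mul_ne_zero ?_ ?_) h1
      · exact Finset.prod_ne_zero_iff.2 fun i hi => by simp [hv i (hIs hi)]
      · exact Finset.prod_ne_zero_iff.2 fun i hi =>
          mt (hw i).1 (Finset.mem_compl.1 hi)
    · intro J hJ hJI
      have hJn : J.card = n := (Finset.mem_powersetCard.1 hJ).2
      obtain ⟨i, hi, hiJ⟩ : ∃ i ∈ I, i ∉ J := Finset.not_subset.1 fun hsub =>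
        hJI (Finset.eq_of_subset_of_card_le hsub (by omega)).symm
      rw [Finset.prod_eq_zero (Finset.mem_compl.2 hiJ) ((hw i).2 hi), mul_zero, mul_zero]
  · simpa only [map_sum, map_mul, map_prod, MvPolynomial.eval_C, eval_linFormPoly, lformM,
      Sum.elim_inl, Sum.elim_inr] using hrel z
end
end

section
/- Let n ≥ 1, let f and g be meromorphic mappings of ℂ into ℙⁿ(ℂ) given by reduced representations with f linearly nondegenerate, and let {H_i}_{i=1}^{2n+2} and {G_i}_{i=1}^{2n+2} be two families of hyperplanes of ℙⁿ(ℂ), each in general position, satisfying: (a) f⁻¹(H_i) ∩ f⁻¹(H_j) = ∅ for all 1 ≤ i < j ≤ 2n+2; (b) f⁻¹(H_i) = g⁻¹(G_i) for i = 1,…,2n+1; (c) min(ν_{(f,H_{2n+2})}, n+1) = min(ν_{(g,G_{2n+2})}, n+1); (d) (f,H_v)·(g,G_j) = (g,G_v)·(f,H_j) at every point of ⋃_{i=1}^{2n+2} f⁻¹(H_i) ∖ f⁻¹(H_j), for all 1 ≤ v, j ≤ 2n+2. Let A and B be the (n+1)×(n+1) matrices whose rows are the chosen coefficient vectors of H₁,…,H_{n+1}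 and of G₁,…,G_{n+1} respectively, and let ℒ be the projective linear transformation of ℙⁿ(ℂ) induced by C = A⁻¹B. Then ℒ(G_i) = H_i for every i = 1,…,2n+2. (Intermediate claim in the proof of the theorem of Section 3, one-variable case m = 1.) -/
open MeasureTheory Filter Topology

noncomputable section

/-- `f` is a reduced representation of a meromorphic map `ℂ → ℙⁿ(ℂ)`:
the components are entire functions with no common zero
(hence not all identically zero). -/
def ReducedRepr (n : ℕ) (f : Fin (n + 1) → ℂ → ℂ) : Prop :=
  (∀ i, Differentiable ℂ (f i)) ∧ ∀ z : ℂ, ∃ i, f i z ≠ 0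

/-- The entire function `(f, H) = a₀f₀ + ⋯ + aₙfₙ` attached to the hyperplane
with coefficient vector `a`. -/
def lform {n : ℕ} (a : Fin (n + 1) → ℂ) (f : Fin (n + 1) → ℂ → ℂ) (z : ℂ) : ℂ :=
  ∑ i, a i * f i z

/-- The vanishing order of the entire function `F` at `z`
(the least `k` such that the `k`-th derivative does not vanish at `z`). -/
def vord (F : ℂ → ℂ) (z : ℂ) : ℕ :=
  sInf {k : ℕ | iteratedDeriv k F z ≠ 0}

/-- `f` and `g` share the hyperplane with coefficient vector `a` with
multiplicity truncated by `d`: the truncated zero divisors of `(f,H)` and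
`(g,H)` agree and `f(z) = g(z)` (as points of `ℙⁿ(ℂ)`) on `f⁻¹(H)`. -/
def SharesTrunc {n : ℕ} (f g : Fin (n + 1) → ℂ → ℂ) (a : Fin (n + 1) → ℂ) (d : ℕ) : Prop :=
  (∃ z, lform a f z ≠ 0) ∧ (∃ z, lform a g z ≠ 0) ∧
  (∀ z, min (vord (lform a f) z) d = min (vord (lform a g) z) d) ∧
  ∀ z, lform a f z = 0 → ∃ c : ℂ, c ≠ 0 ∧ ∀ i, g i z = c * f i z

/-- The map `f × g : ℂ → ℙⁿ(ℂ) × ℙⁿ(ℂ)` is algebraically degenerate: a nonzero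
polynomial `Q(v, w)`, homogeneous in `v` and in `w` separately, annihilates
`(f₀, …, fₙ, g₀, …, gₙ)`. -/
def AlgDeg {n : ℕ} (f g : Fin (n + 1) → ℂ → ℂ) : Prop :=
  ∃ Q : MvPolynomial (Fin (n + 1) ⊕ Fin (n + 1)) ℂ, Q ≠ 0 ∧
    (∃ d₁ : ℕ, MvPolynomial.IsWeightedHomogeneous (Sum.elim (fun _ => 1) (fun _ => 0)) Q d₁) ∧
    (∃ d₂ : ℕ, MvPolynomial.IsWeightedHomogeneous (Sum.elim (fun _ => 0) (fun _ => 1)) Q d₂) ∧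
    ∀ z : ℂ, MvPolynomial.eval (Sum.elim (fun i => f i z) (fun i => g i z)) Q = 0

section

open Metric Real

lemma log_norm_le_circleAverage_of_order_nonneg {Φ : ℂ → ℂ} {c : ℂ} {r : ℝ} (hr : 0 < r)
    (hΦ : MeromorphicOn Φ (closedBall c r))
    (hord : ∀ z ∈ closedBall c r, 0 ≤ meromorphicOrderAt Φ z)
    (hc : AnalyticAt ℂ Φ c) (hc0 : Φ c ≠ 0) :
    Real.log ‖Φ c‖ ≤ circleAverage (fun z ↦ Real.log ‖Φ z‖) c r := by
  have habs : |r| = r := abs_of_pos hr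
  have key := MeromorphicOn.circleAverage_log_norm (f := Φ) (c := c) (R := r) hr.ne'
    (by rwa [habs])
  rw [habs, hΦ.divisor_apply (by simp [hr.le]), hc.meromorphicTrailingCoeffAt_of_ne_zero hc0,
    hc.meromorphicOrderAt_eq, hc.analyticOrderAt_eq_zero.mpr hc0] at key
  rw [key]
  simp only [ENat.map_zero, WithTop.untop₀_zero, Int.cast_zero, zero_mul, CharP.cast_eq_zero,
    WithTop.coe_zero, add_zero]
  refine le_add_of_nonneg_left (finsum_nonneg fun u ↦ ?_)
  by_cases hu : u ∈ closedBall c r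
  · refine mul_nonneg ?_ ?_
    · rw [hΦ.divisor_apply hu]
      exact_mod_cast WithTop.untop₀_nonneg.2 (hord u hu)
    · by_cases huc : c - u = 0
      · simp [huc]
      · refine Real.log_nonneg ?_
        rw [← div_eq_mul_inv, one_le_div (by positivity)]
        rwa [mem_closedBall, dist_eq_norm, norm_sub_rev] at hu
  · simp [hu]

lemma circleAverage_re_of_differentiable {q : ℂ → ℂ} (hq : Differentiable ℂ q) (c : ℂ) (r : ℝ) :
    circleAverage (fun z ↦ (q z).re) c r = (q c).re := by
  have h1 : circleAverage q c r = q c := hq.diffContOnCl.circleAverage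
  have h2 := Complex.reCLM.circleAverage_comp_comm (f := q) (c := c) (R := r)
    (hq.continuous.continuousOn.circleIntegrable')
  rw [h1] at h2
  simpa [Function.comp_def] using h2

/-- A positive continuous function on a circle is the modulus of a zero-free entire function,
up to a factor between `e⁻¹` and `e`. -/
lemma exists_entire_re_approx {u : ℂ → ℝ} (hu : Continuous u) (c : ℂ) {R : ℝ} (hR : 0 < R) :
    ∃ q : ℂ → ℂ, Differentiable ℂ q ∧ ∀ z ∈ sphere c R, |(q z).re - u z| ≤ 1 := by
  have : Fact (0 < 2 * π) := ⟨by positivity⟩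
  have hper : Function.Periodic (fun x : ℝ ↦ ((u (circleMap c R x) : ℝ) : ℂ)) (2 * π) := by
    intro x
    simp [periodic_circleMap c R x]
  have hcont : Continuous (hper.lift) := by
    refine continuous_coinduced_dom.mpr ?_
    change Continuous fun x : ℝ ↦ ((u (circleMap c R x) : ℝ) : ℂ)
    fun_prop
  let φ : C(AddCircle (2 * π), ℂ) := ⟨hper.lift, hcont⟩
  have hmem : φ ∈ (Submodule.span ℂ (Set.range <| @fourier (2 * π))).topologicalClosure := by
    rw [span_fourier_closure_eq_top]; trivial
  obtain ⟨p, hp, hpd⟩ := Metric.mem_closure_iff.1 hmem 1 one_pos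
  have hspan : ∀ p ∈ Submodule.span ℂ (Set.range <| @fourier (2 * π)), ∀ a : ℂ,
      ∃ q : ℂ → ℂ, Differentiable ℂ q ∧
        ∀ x : ℝ, (q (circleMap c R x)).re = (a * p (x : AddCircle (2 * π))).re := by
    intro p hp
    induction hp using Submodule.span_induction with
    | mem p hp =>
      obtain ⟨k, rfl⟩ := hp
      intro a
      have hpi : (π : ℂ) ≠ 0 := by exact_mod_cast pi_ne_zero
      have hRc : (R : ℂ) ≠ 0 := by exact_mod_cast hR.ne'
      rcases Int.eq_nat_or_neg k with ⟨m, rfl | rfl⟩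
      · refine ⟨fun z ↦ a * ((z - c) / R) ^ m, by fun_prop, fun x ↦ ?_⟩
        rw [fourier_coe_apply]
        have : (circleMap c R x - c) / R = Complex.exp (x * Complex.I) := by
          simp [circleMap, hRc]
        simp only [this, ← Complex.exp_nat_mul]
        congr 3
        push_cast
        field_simp
      · refine ⟨fun z ↦ (starRingEnd ℂ a) * ((z - c) / R) ^ m, by fun_prop, fun x ↦ ?_⟩
        rw [fourier_coe_apply]
        have : (circleMap c R x - c) / R = Complex.exp (x * Complex.I) := by
          simp [circleMap, hRc]
        simp only [this, ← Complex.exp_nat_mul]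
        rw [← Complex.conj_re]
        congr 1
        rw [map_mul, ← Complex.exp_conj]
        simp only [map_mul, Complex.conj_I, Complex.conj_ofReal, Complex.conj_conj, map_natCast]
        congr 2
        push_cast
        field_simp
    | zero => exact fun a ↦ ⟨0, differentiable_const _, by simp⟩
    | add p₁ p₂ _ _ h₁ h₂ =>
      intro a
      obtain ⟨q₁, hq₁, h₁⟩ := h₁ a
      obtain ⟨q₂, hq₂, h₂⟩ := h₂ a
      exact ⟨q₁ + q₂, hq₁.add hq₂, fun x ↦ by simp [h₁, h₂, mul_add]⟩
    | smul b p _ h =>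
      intro a
      obtain ⟨q, hq, h⟩ := h (a * b)
      exact ⟨q, hq, fun x ↦ by simp [h, mul_assoc]⟩
  obtain ⟨q, hq, hqp⟩ := hspan p hp 1
  refine ⟨q, hq, fun z hz ↦ ?_⟩
  obtain ⟨x, rfl⟩ : ∃ x, circleMap c R x = z := by
    have := range_circleMap c R
    rw [abs_of_pos hR] at this
    rw [← this] at hz
    exact hz
  have h1 : dist (φ x) (p x) ≤ dist φ p := ContinuousMap.dist_apply_le_dist _
  have h2 : φ (x : AddCircle (2 * π)) = ((u (circleMap c R x) : ℝ) : ℂ) := rfl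
  rw [hqp, one_mul, abs_sub_comm]
  calc |u (circleMap c R x) - (p x).re| = |(φ x - p x).re| := by simp [h2]
    _ ≤ ‖φ x - p x‖ := Complex.abs_re_le_norm _
    _ ≤ 1 := by rw [← dist_eq_norm]; linarith

/-- For a bounded zero-free holomorphic function on a disc, the derivatives at the centre are
controlled by the value there, up to a logarithmic factor. -/
lemma norm_iteratedDeriv_le_of_ne_zero_on_ball {F : ℂ → ℂ} {z : ℂ} {δ C : ℝ} (hδ : 0 < δ)
    (hF : Differentiable ℂ F) (h0 : ∀ w ∈ ball z δ, F w ≠ 0) (hC : ∀ w ∈ ball z δ, ‖F w‖ ≤ C)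
    (k : ℕ) :
    ‖iteratedDeriv k F z‖ ≤
      k.factorial * Real.exp 2 * (4 * (1 + Real.log (C / ‖F z‖)) / δ) ^ k * ‖F z‖ := by
  have hz : z ∈ ball z δ := mem_ball_self hδ
  have hFz : 0 < ‖F z‖ := norm_pos_iff.2 (h0 z hz)
  set M := Real.log (C / ‖F z‖) with hM
  have hM0 : 0 ≤ M := Real.log_nonneg (by rw [one_le_div hFz]; exact hC z hz)
  obtain ⟨u, hu⟩ := DifferentiableOn.isExactOn_ball (f := fun w ↦ deriv F w / F w) (c := z)
    (r := δ) (DifferentiableOn.div hF.deriv.differentiableOn hF.differentiableOn h0)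
  have hexp : ∀ w ∈ ball z δ, F w = F z * Complex.exp (u w - u z) := by
    have hconst : ∀ w ∈ ball z δ, F w * Complex.exp (-u w) = F z * Complex.exp (-u z) := by
      intro w hw
      refine (convex_ball z δ).is_const_of_fderivWithin_eq_zero (𝕜 := ℂ)
        (f := fun w ↦ F w * Complex.exp (-u w)) ?_ ?_ hw hz
      · intro w hw
        exact (hF w).differentiableWithinAt.mul
          ((hu w hw).differentiableAt.neg.cexp).differentiableWithinAt
      · intro w hw
        have hd : HasDerivAt (fun w ↦ F w * Complex.exp (-u w)) 0 w := by
          have := (hF w).hasDerivAt.mul ((hu w hw).neg.cexp)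
          refine this.congr_deriv ?_
          field_simp [h0 w hw]
          simp
        rw [fderivWithin_eq_fderiv (isOpen_ball.uniqueDiffWithinAt hw) hd.differentiableAt]
        ext
        simp [hd.deriv]
    intro w hw
    have := hconst w hw
    rw [sub_eq_add_neg, Complex.exp_add]
    have e : Complex.exp (-u w) * Complex.exp (u w) = 1 := by
      rw [← Complex.exp_add]; simp
    linear_combination (Complex.exp (u w)) * this - F w * e
  have hre : ∀ w ∈ ball z δ, (u w - u z).re ≤ M + 1 := by
    intro w hw
    have h1 : ‖F w‖ = ‖F z‖ * Real.exp ((u w - u z).re) := by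
      rw [hexp w hw, norm_mul, Complex.norm_exp]
    have h2 : Real.exp ((u w - u z).re) ≤ C / ‖F z‖ := by
      rw [le_div_iff₀ hFz, mul_comm, ← h1]; exact hC w hw
    have := (Real.le_log_iff_exp_le (lt_of_lt_of_le (Real.exp_pos _) h2)).2 h2
    linarith
  set ρ := δ / (4 * (1 + M)) with hρ
  have hρ0 : 0 < ρ := by positivity
  have hρδ : ρ ≤ δ / 4 := by
    rw [hρ]; gcongr; linarith
  have hbound : ∀ w ∈ sphere z ρ, ‖F w‖ ≤ ‖F z‖ * Real.exp 2 := by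
    intro w hw
    have hwn : ‖w - z‖ = ρ := by simpa [dist_eq_norm] using hw
    have hwb : w ∈ ball z δ := by rw [mem_ball, dist_eq_norm, hwn]; linarith
    rw [hexp w hwb, norm_mul, Complex.norm_exp]
    gcongr
    have hBC := Complex.borelCaratheodory_zero (f := fun v ↦ u (z + v) - u z) (M := M + 1)
      (R := δ) (z := w - z) (by linarith) (by
        intro v hv
        have hv' : z + v ∈ ball z δ := by simpa [dist_eq_norm] using hv
        have := (hu (z + v) hv').differentiableAt
        exact ((this.comp v ((differentiableAt_const z).add differentiableAt_id)).sub_const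
          _).differentiableWithinAt) (by
        intro v hv
        exact hre _ (by simpa [dist_eq_norm] using hv)) hδ
      (by rw [mem_ball_zero_iff, hwn]; linarith) (by simp)
    simp only [add_sub_cancel] at hBC
    refine (Complex.re_le_norm _).trans (hBC.trans ?_)
    rw [hwn, div_le_iff₀ (by linarith)]
    have : ρ * (4 * (1 + M)) = δ := by rw [hρ]; field_simp
    nlinarith
  have := Complex.norm_iteratedDeriv_le_of_forall_mem_sphere_norm_le k hρ0
    (hF.diffContOnCl) hbound
  refine this.trans (le_of_eq ?_)
  have hinv : 4 * (1 + M) / δ = ρ⁻¹ := by rw [hρ, inv_div]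
  rw [hinv, inv_pow]
  ring

lemma intervalIntegrable_inv_sqrt_abs_sin (a b : ℝ) :
    IntervalIntegrable (fun θ ↦ (√|sin θ|)⁻¹) volume a b := by
  have hmeas : Measurable fun θ ↦ (√|sin θ|)⁻¹ := by fun_prop
  have h1 : IntervalIntegrable (fun θ ↦ (√|sin θ|)⁻¹) volume 0 (π / 2) := by
    have hg : IntervalIntegrable (fun x : ℝ ↦ (√(2 / π))⁻¹ * x ^ (-(1 / 2) : ℝ)) volume 0 (π / 2) :=
      (intervalIntegral.intervalIntegrable_rpow' (by norm_num)).const_mul _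
    refine hg.mono_fun hmeas.aestronglyMeasurable ?_
    refine (ae_restrict_iff' measurableSet_uIoc).2 (ae_of_all _ fun x hx ↦ ?_)
    rw [Set.uIoc_of_le (by positivity)] at hx
    have hx0 := hx.1
    have hs := mul_le_sin hx.1.le hx.2
    have hpos : 0 < 2 / π * x := by positivity
    beta_reduce
    rw [rpow_neg hx.1.le, ← sqrt_eq_rpow, norm_of_nonneg (by positivity),
      norm_of_nonneg (by positivity), ← mul_inv, ← sqrt_mul (by positivity),
      abs_of_pos (hpos.trans_le hs)]
    gcongr
  have h2 : IntervalIntegrable (fun θ ↦ (√|sin θ|)⁻¹) volume (π / 2) π := by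
    have := (h1.comp_sub_left π).symm
    simpa [sin_pi_sub, sub_half] using this
  have hper : Function.Periodic (fun θ ↦ (√|sin θ|)⁻¹) π := by
    intro θ; simp [sin_add_pi]
  refine hper.intervalIntegrable (t := 0) pi_ne_zero ?_ a b
  simpa using h1.trans h2

lemma abs_sin_le_norm_circleMap_sub (c a : ℂ) {r : ℝ} (hr : 1 ≤ r) (θ : ℝ) :
    |sin (θ - (a - c).arg)| ≤ ‖circleMap c r θ - a‖ := by
  set α := (a - c).arg
  have h1 : circleMap c r θ - a = r * Complex.exp (θ * Complex.I) -
      ‖a - c‖ * Complex.exp (α * Complex.I) := by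
    rw [Complex.norm_mul_exp_arg_mul_I]; simp [circleMap]; ring
  have h2 : circleMap c r θ - a = Complex.exp (α * Complex.I) *
      (r * Complex.exp ((θ - α : ℝ) * Complex.I) - ‖a - c‖) := by
    rw [h1, mul_sub, mul_left_comm, ← Complex.exp_add]
    push_cast
    ring_nf
  have h3 : (r * Complex.exp ((θ - α : ℝ) * Complex.I) - ‖a - c‖ : ℂ).im = r * sin (θ - α) := by
    rw [Complex.sub_im, Complex.im_ofReal_mul, Complex.exp_ofReal_mul_I_im, Complex.ofReal_im,
      sub_zero]
  rw [h2, norm_mul, Complex.norm_exp_ofReal_mul_I, one_mul]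
  refine le_trans ?_ (Complex.abs_im_le_norm _)
  rw [h3, abs_mul, abs_of_nonneg (by linarith : 0 ≤ r)]
  exact le_mul_of_one_le_left (abs_nonneg _) hr

lemma exists_circleAverage_inv_sqrt_norm_sub_le :
    ∃ K : ℝ, 0 ≤ K ∧ ∀ (c a : ℂ) (r : ℝ), 1 ≤ r →
      CircleIntegrable (fun z ↦ (√‖z - a‖)⁻¹) c r ∧
      circleAverage (fun z ↦ (√‖z - a‖)⁻¹) c r ≤ K := by
  have hper : Function.Periodic (fun θ ↦ (√|sin θ|)⁻¹) (2 * π) := by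
    intro θ; simp
  refine ⟨(2 * π)⁻¹ * ∫ θ in (0)..(2 * π), (√|sin θ|)⁻¹, ?_, fun c a r hr ↦ ?_⟩
  · refine mul_nonneg (by positivity)
      (intervalIntegral.integral_nonneg (by positivity) fun _ _ ↦ by positivity)
  set α := (a - c).arg
  have hint : IntervalIntegrable (fun θ ↦ (√|sin (θ - α)|)⁻¹) volume 0 (2 * π) := by
    simpa using (intervalIntegrable_inv_sqrt_abs_sin (0 - α) (2 * π - α)).comp_sub_right α
  have hae : ∀ᵐ θ : ℝ, (√‖circleMap c r θ - a‖)⁻¹ ≤ (√|sin (θ - α)|)⁻¹ := by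
    have hcount : {θ : ℝ | sin (θ - α) = 0}.Countable := by
      refine (Set.countable_range fun k : ℤ ↦ k * π + α).mono fun θ hθ ↦ ?_
      obtain ⟨k, hk⟩ := sin_eq_zero_iff.1 hθ
      exact ⟨k, by simp only [hk]; ring⟩
    filter_upwards [hcount.ae_notMem volume] with θ hθ
    have h0 : 0 < |sin (θ - α)| := abs_pos.2 hθ
    have := abs_sin_le_norm_circleMap_sub c a hr θ
    gcongr
  have hI : CircleIntegrable (fun z ↦ (√‖z - a‖)⁻¹) c r := by
    refine hint.mono_fun (Measurable.aestronglyMeasurable (by fun_prop)) ?_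
    refine ae_restrict_of_ae ?_
    filter_upwards [hae] with θ hθ
    rwa [norm_of_nonneg (by positivity), norm_of_nonneg (by positivity)]
  refine ⟨hI, ?_⟩
  rw [circleAverage_def, smul_eq_mul]
  gcongr
  calc ∫ θ in (0)..(2 * π), (√‖circleMap c r θ - a‖)⁻¹
      ≤ ∫ θ in (0)..(2 * π), (√|sin (θ - α)|)⁻¹ :=
        intervalIntegral.integral_mono_ae (by positivity) hI hint hae
    _ = ∫ θ in (0 - α)..(2 * π - α), (√|sin θ|)⁻¹ :=
        intervalIntegral.integral_comp_sub_right (fun θ ↦ (√|sin θ|)⁻¹) α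
    _ = ∫ θ in (0)..(2 * π), (√|sin θ|)⁻¹ := by
        have := hper.intervalIntegral_add_eq (-α) 0
        rw [zero_add] at this
        rw [← this]
        congr 1 <;> ring

/-- **Counting of zeros** of a bounded holomorphic function by Jensen's formula. -/
lemma card_zeros_mul_log_le {F : ℂ → ℂ} (hF : Differentiable ℂ F) {c : ℂ} {r R M : ℝ}
    (hr : 0 < r) (hrR : r < R) (hM : 1 ≤ M) (hc : F c ≠ 0)
    (hb : ∀ z ∈ sphere c R, ‖F z‖ ≤ M) :
    ∃ Z : Finset ℂ, (∀ z ∈ closedBall c r, F z = 0 → z ∈ Z) ∧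
      Z.card * Real.log (R / r) ≤ Real.log (M / ‖F c‖) := by
  have hR : 0 < R := hr.trans hrR
  have hA : AnalyticOnNhd ℂ F Set.univ := hF.differentiableOn.analyticOnNhd isOpen_univ
  have hA' : AnalyticOnNhd ℂ F (closedBall c r) := hA.mono (Set.subset_univ _)
  have key := AnalyticOnNhd.sum_divisor_le (c := c) (r := r) (R := R) (M := M) (f := F)
    (by rwa [abs_of_pos hr]) (by rwa [abs_of_pos hr, abs_of_pos hR]) hM
    (hA.mono (Set.subset_univ _)) hc (by rwa [abs_of_pos hR])
  rw [abs_of_pos hr] at key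
  set D := MeromorphicOn.divisor F (closedBall c r)
  have hfin : D.support.Finite := D.finiteSupport (isCompact_closedBall c r)
  have hne : ∀ z, analyticOrderAt F z ≠ ⊤ := by
    intro z hz
    have h1 := analyticOrderAt_eq_top.1 hz
    have h2 := hA.eqOn_zero_of_preconnected_of_eventuallyEq_zero isPreconnected_univ
      (Set.mem_univ z) h1
    exact hc (h2 (Set.mem_univ c))
  have hpos : ∀ z ∈ closedBall c r, F z = 0 → 1 ≤ D z := by
    intro z hz h0
    have hz' : analyticOrderAt F z ≠ 0 := by
      rw [Ne, (hA z trivial).analyticOrderAt_eq_zero]; simpa using h0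
    rw [MeromorphicOn.AnalyticOnNhd.divisor_apply hA' hz]
    obtain ⟨m, hm⟩ := ENat.ne_top_iff_exists.1 (hne z)
    rw [← hm] at hz' ⊢
    have : m ≠ 0 := by exact_mod_cast hz'
    simp
    omega
  refine ⟨hfin.toFinset, fun z hz h0 ↦ ?_, ?_⟩
  · simpa using (by have := hpos z hz h0; omega : D z ≠ 0)
  have hlog : 0 < Real.log (R / r) := Real.log_pos ((one_lt_div hr).2 hrR)
  rw [le_div_iff₀ hlog] at key
  refine le_trans ?_ key
  gcongr
  have hsum : ∑ᶠ u, D u = ∑ u ∈ hfin.toFinset, D u :=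
    finsum_eq_sum_of_support_subset _ (by simp)
  rw [hsum]
  have : (hfin.toFinset.card : ℤ) ≤ ∑ u ∈ hfin.toFinset, D u := by
    rw [Finset.card_eq_sum_ones]
    push_cast
    refine Finset.sum_le_sum fun u hu ↦ ?_
    have hu' : D u ≠ 0 := by simpa using hu
    have : 0 ≤ D u := MeromorphicOn.AnalyticOnNhd.divisor_nonneg hA' u
    omega
  exact_mod_cast this
/-- The Wronskian matrix: row `k` holds the `k`-th derivatives of the components. -/
def wronskianMatrix {m : ℕ} (f : Fin m → ℂ → ℂ) (z : ℂ) : Matrix (Fin m) (Fin m) ℂ :=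
  Matrix.of fun k i ↦ iteratedDeriv k (f i) z

lemma Differentiable.iteratedDeriv_complex {F : ℂ → ℂ} (hF : Differentiable ℂ F) (k : ℕ) :
    Differentiable ℂ (iteratedDeriv k F) :=
  hF.contDiff.differentiable_iteratedDeriv' k

lemma Differentiable.matrix_det {m : ℕ} {M : ℂ → Matrix (Fin m) (Fin m) ℂ}
    (hM : ∀ i j, Differentiable ℂ fun z ↦ M z i j) : Differentiable ℂ fun z ↦ (M z).det := by
  simp only [Matrix.det_apply]
  fun_prop

lemma Differentiable.matrix_adjugate {m : ℕ} {M : ℂ → Matrix (Fin m) (Fin m) ℂ}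
    (hM : ∀ i j, Differentiable ℂ fun z ↦ M z i j) (i j : Fin m) :
    Differentiable ℂ fun z ↦ (M z).adjugate i j := by
  simp only [Matrix.adjugate_apply]
  refine Differentiable.matrix_det fun a b ↦ ?_
  simp only [Matrix.updateRow_apply]
  split_ifs
  · exact differentiable_const _
  · exact hM a b

lemma differentiable_wronskianMatrix {m : ℕ} {f : Fin m → ℂ → ℂ}
    (hf : ∀ i, Differentiable ℂ (f i)) (k i : Fin m) :
    Differentiable ℂ fun z ↦ wronskianMatrix f z k i :=
  (hf i).iteratedDeriv_complex k

lemma le_analyticOrderAt_sum {ι : Type*} (s : Finset ι) {F : ι → ℂ → ℂ} {z : ℂ} {μ : ℕ∞}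
    (h : ∀ i ∈ s, μ ≤ analyticOrderAt (F i) z) :
    μ ≤ analyticOrderAt (fun w ↦ ∑ i ∈ s, F i w) z := by
  classical
  induction s using Finset.induction_on with
  | empty =>
    have : analyticOrderAt (fun _ : ℂ ↦ (0 : ℂ)) z = ⊤ :=
      analyticOrderAt_eq_top.2 (Eventually.of_forall fun _ ↦ rfl)
    simp [this]
  | insert a s ha ih =>
    simp only [Finset.sum_insert ha]
    refine le_trans (le_min ?_ ?_) le_analyticOrderAt_add
    · exact h a (Finset.mem_insert_self a s)
    · exact ih fun i hi ↦ h i (Finset.mem_insert_of_mem hi)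

lemma le_analyticOrderAt_mul_right {F G : ℂ → ℂ} {z : ℂ} {μ : ℕ∞} (hF : AnalyticAt ℂ F z)
    (hG : AnalyticAt ℂ G z) (h : μ ≤ analyticOrderAt G z) :
    μ ≤ analyticOrderAt (fun w ↦ F w * G w) z := by
  have := analyticOrderAt_mul hF hG
  change _ ≤ analyticOrderAt (F * G) z
  rw [this]
  exact h.trans le_add_self

lemma iteratedDeriv_sum_const_mul {m : ℕ} {f : Fin m → ℂ → ℂ} (hf : ∀ i, Differentiable ℂ (f i))
    (a : Fin m → ℂ) (k : ℕ) (z : ℂ) :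
    iteratedDeriv k (fun w ↦ ∑ i, a i * f i w) z = ∑ i, a i * iteratedDeriv k (f i) z := by
  rw [iteratedDeriv_fun_sum fun i _ ↦ (contDiffAt_const.mul (hf i).contDiff.contDiffAt)]
  simp [iteratedDeriv_const_mul_field]

/-- **Wronskian criterion**: linearly independent entire functions have a Wronskian that does
not vanish identically. -/
theorem exists_det_wronskianMatrix_ne_zero {m : ℕ} {f : Fin m → ℂ → ℂ}
    (hf : ∀ i, Differentiable ℂ (f i)) (hlin : LinearIndependent ℂ f) :
    ∃ z, (wronskianMatrix f z).det ≠ 0 := by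
  by_contra! hW
  let v : ℕ → ℂ → Fin m → ℂ := fun k z i ↦ iteratedDeriv k (f i) z
  let P : ℕ → ℂ → Prop := fun k z ↦ LinearIndependent ℂ fun j : Fin k ↦ v j z
  obtain ⟨k, ⟨z₀, hz₀⟩, hk⟩ : ∃ k, (∃ z, P k z) ∧ ¬ ∃ z, P (k + 1) z := by
    by_contra! hcon
    have hall : ∀ k, ∃ z, P k z := by
      intro k
      induction k with
      | zero => exact ⟨0, linearIndependent_empty_type⟩
      | succ k ih => exact hcon k ih
    obtain ⟨z, hz⟩ := hall m
    have : LinearIndependent ℂ (wronskianMatrix f z).row := hz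
    rw [Matrix.linearIndependent_rows_iff_isUnit, Matrix.isUnit_iff_isUnit_det] at this
    exact this.ne_zero (hW z)
  push Not at hk
  have hkm : k < m := by
    have h1 := hz₀.fintype_card_le_finrank
    simp at h1
    rcases h1.lt_or_eq with h | rfl
    · exact h
    · exfalso
      have : LinearIndependent ℂ (wronskianMatrix f z₀).row := hz₀
      rw [Matrix.linearIndependent_rows_iff_isUnit, Matrix.isUnit_iff_isUnit_det] at this
      exact this.ne_zero (hW z₀)
  let M : ℂ → Matrix (Fin m) (Fin k) ℂ := fun z ↦ Matrix.of fun i j ↦ v j z i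
  obtain ⟨S, hS⟩ : ∃ S : Matrix (Fin k) (Fin m) ℂ, S * M z₀ = 1 := by
    have hinj : Function.Injective (M z₀).mulVec := by
      rw [Matrix.mulVec_injective_iff]
      exact hz₀
    obtain ⟨S, hS⟩ := (M z₀).mulVecLin.exists_leftInverse_of_injective (LinearMap.ker_eq_bot.2 hinj)
    refine ⟨LinearMap.toMatrix' S, ?_⟩
    rw [← LinearMap.toMatrix'_id, ← hS, LinearMap.toMatrix'_comp, ← Matrix.toLin'_apply',
      LinearMap.toMatrix'_toLin']
  have hv : ∀ l i, Differentiable ℂ fun z ↦ v l z i := fun l i ↦ (hf i).iteratedDeriv_complex l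
  let N : ℂ → Matrix (Fin k) (Fin k) ℂ := fun z ↦ S * M z
  have hN : ∀ i j, Differentiable ℂ fun z ↦ N z i j := by
    intro i j
    simp only [N, M, Matrix.mul_apply, Matrix.of_apply]
    exact Differentiable.fun_sum fun l _ ↦ (hv _ _).const_mul _
  have hNdet := Differentiable.matrix_det hN
  have hdet0 : (N z₀).det ≠ 0 := by simp [N, hS]
  have hev : ∀ᶠ z in 𝓝 z₀, (N z).det ≠ 0 := hNdet.continuous.continuousAt.eventually_ne hdet0
  let a : Fin k → ℂ → ℂ := fun i z ↦ ((N z)⁻¹.mulVec (S.mulVec (v k z))) i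
  have ha : ∀ i, AnalyticAt ℂ (a i) z₀ := by
    intro i
    have hd : ∀ᶠ z in 𝓝 z₀, DifferentiableAt ℂ (a i) z := by
      filter_upwards [hev] with z hz
      have : a i = fun z ↦ ((N z).det)⁻¹ * ∑ j, (N z).adjugate i j * ∑ l, S j l * v k z l := by
        funext z
        simp only [a, Matrix.inv_def, Matrix.mulVec,
          dotProduct, Ring.inverse_eq_inv', smul_eq_mul, Matrix.smul_apply, Finset.mul_sum,
          mul_assoc]
      rw [this]
      refine ((hNdet z).inv hz).mul (Differentiable.fun_sum (fun j _ ↦ ?_) z)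
      exact (Differentiable.matrix_adjugate hN i j).mul
        (Differentiable.fun_sum fun l _ ↦ (hv _ _).const_mul _)
    exact Complex.analyticAt_iff_eventually_differentiableAt.2 hd
  have hrel : ∀ᶠ z in 𝓝 z₀, ∀ i, v k z i = ∑ j, a j z * v j z i := by
    filter_upwards [hev] with z hz
    have hu : IsUnit (N z).det := hz.isUnit
    have hPk : P k z := by
      have hinj : Function.Injective (M z).mulVec := by
        intro x y hxy
        have : (N z).mulVec x = (N z).mulVec y := by
          simp only [N, ← Matrix.mulVec_mulVec, hxy]
        exact Matrix.mulVec_injective_of_isUnit ((Matrix.isUnit_iff_isUnit_det _).2 hu) this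
      exact (Matrix.mulVec_injective_iff.1 hinj)
    have hmem : v k z ∈ Submodule.span ℂ (Set.range fun j : Fin k ↦ v j z) := by
      by_contra hnot
      refine hk z ?_
      have := linearIndependent_finSnoc.2 ⟨hPk, hnot⟩
      have hEq : (fun j : Fin (k + 1) ↦ v j z) =
          Fin.snoc (α := fun _ ↦ Fin m → ℂ) (fun j : Fin k ↦ v j z) (v k z) := by
        funext j
        refine Fin.lastCases ?_ (fun j ↦ ?_) j <;> simp
      change LinearIndependent ℂ _
      rw [hEq]
      exact this
    obtain ⟨b, hb⟩ := (Submodule.mem_span_range_iff_exists_fun ℂ).1 hmem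
    have hb' : (M z).mulVec b = v k z := by
      rw [← hb]; funext i; simp [M, Matrix.mulVec, dotProduct, mul_comm]
    have hab : (fun j ↦ a j z) = b := by
      funext j
      simp only [a]
      rw [← hb', Matrix.mulVec_mulVec b S, Matrix.mulVec_mulVec]
      change ((N z)⁻¹ * N z).mulVec b j = b j
      rw [Matrix.nonsing_inv_mul _ hu, Matrix.one_mulVec]
    intro i
    rw [← hb, ← hab]
    simp
  obtain ⟨ℓ, hℓ0, hℓ⟩ : ∃ ℓ : Fin m → ℂ, ℓ ≠ 0 ∧ ∀ j : Fin k, ∑ i, ℓ i * v j z₀ i = 0 := by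
    have hlt : Module.finrank ℂ (Fin k → ℂ) < Module.finrank ℂ (Fin m → ℂ) := by simpa
    have hker := LinearMap.ker_ne_bot_of_finrank_lt (f := (M z₀).vecMulLinear) hlt
    obtain ⟨ℓ, hℓ, hℓ0⟩ := Submodule.exists_mem_ne_zero_of_ne_bot hker
    refine ⟨ℓ, hℓ0, fun j ↦ ?_⟩
    have := congrFun (LinearMap.mem_ker.1 hℓ) j
    simpa [Matrix.vecMul, dotProduct, M] using this
  let y : ℕ → ℂ → ℂ := fun l z ↦ ∑ i, ℓ i * v l z i
  have hy : ∀ l, Differentiable ℂ (y l) := fun l ↦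
    Differentiable.fun_sum fun i _ ↦ (hv l i).const_mul _
  have hyan : ∀ l, AnalyticAt ℂ (y l) z₀ := fun l ↦ (hy l).analyticAt z₀
  have hyd : ∀ l, deriv (y l) = y (l + 1) := by
    intro l
    funext z
    simp only [y]
    rw [deriv_fun_sum fun i _ ↦ ((hv l i).const_mul _) z]
    refine Finset.sum_congr rfl fun i _ ↦ ?_
    rw [deriv_const_mul_field]
    simp only [v, iteratedDeriv_succ]
  have hyrel : y k =ᶠ[𝓝 z₀] fun z ↦ ∑ j : Fin k, a j z * y j z := by
    filter_upwards [hrel] with z hz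
    simp only [y, Finset.mul_sum]
    rw [Finset.sum_comm]
    refine Finset.sum_congr rfl fun i _ ↦ ?_
    rw [hz i, Finset.mul_sum]
    exact Finset.sum_congr rfl fun j _ ↦ by ring
  have hord : ∀ μ : ℕ, ∀ l < k, (μ : ℕ∞) ≤ analyticOrderAt (y l) z₀ := by
    intro μ
    induction μ with
    | zero => simp
    | succ μ ih =>
      have hle : ∀ l ≤ k, (μ : ℕ∞) ≤ analyticOrderAt (y l) z₀ := by
        intro l hl
        rcases hl.lt_or_eq with h | rfl
        · exact ih l h
        · rw [analyticOrderAt_congr hyrel]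
          exact le_analyticOrderAt_sum _ fun j _ ↦
            le_analyticOrderAt_mul_right (ha j) (hyan j) (ih j j.2)
      intro l hl
      push_cast
      rw [← analyticOrderAt_deriv_ge_iff (hyan l) (hℓ ⟨l, hl⟩), hyd]
      exact hle _ hl
  have hy0 : analyticOrderAt (y 0) z₀ = ⊤ := by
    refine ENat.eq_top_iff_forall_ge.2 fun μ ↦ ?_
    rcases Nat.eq_zero_or_pos k with rfl | hk0
    · rw [analyticOrderAt_congr hyrel]
      exact le_analyticOrderAt_sum _ fun j _ ↦ j.elim0
    · exact hord μ 0 hk0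
  have hyz : y 0 = 0 := by
    have := (AnalyticOnNhd.analyticOrderAt_eq_top_iff_eq_zero z₀
      (fun z ↦ (hy 0).analyticAt z)).1 hy0
    exact this
  refine hℓ0 (funext ((Fintype.linearIndependent_iff.1 hlin) ℓ ?_))
  funext z
  have := congrFun hyz z
  simpa [y, v] using this

lemma det_wronskianMatrix_mul {m : ℕ} {f : Fin m → ℂ → ℂ} {h : ℂ → ℂ}
    (hf : ∀ i, Differentiable ℂ (f i)) (hh : Differentiable ℂ h) (z : ℂ) :
    (wronskianMatrix (fun i w ↦ h w * f i w) z).det = h z ^ m * (wronskianMatrix f z).det := by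
  let L : Matrix (Fin m) (Fin m) ℂ := Matrix.of fun k l ↦
    if (l : ℕ) ≤ k then ((k : ℕ).choose l : ℂ) * iteratedDeriv (k - l) h z else 0
  have hmul : wronskianMatrix (fun i w ↦ h w * f i w) z = L * wronskianMatrix f z := by
    ext k i
    simp only [wronskianMatrix, Matrix.of_apply, Matrix.mul_apply, L]
    have hcomm : (fun w ↦ h w * f i w) = fun w ↦ f i w * h w := by funext w; ring
    rw [hcomm, iteratedDeriv_fun_mul (hf i).contDiff.contDiffAt hh.contDiff.contDiffAt]
    simp only [ite_mul, zero_mul]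
    rw [Fin.sum_univ_eq_sum_range (fun l ↦ if l ≤ (k : ℕ) then
      ((k : ℕ).choose l : ℂ) * iteratedDeriv (k - l) h z * iteratedDeriv l (f i) z else 0) m]
    rw [← Finset.sum_subset (Finset.range_subset_range.2 (Nat.succ_le_of_lt k.2))]
    · refine Finset.sum_congr rfl fun l hl ↦ ?_
      rw [if_pos (Nat.lt_succ_iff.1 (Finset.mem_range.1 hl))]
      ring
    · intro l _ hl
      exact if_neg fun h ↦ hl (Finset.mem_range.2 (Nat.lt_succ_of_le h))
  rw [hmul, Matrix.det_mul, Matrix.det_of_isLowerTriangular]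
  · congr 1
    simp [L]
  · intro k l hkl
    have : (k : ℕ) < l := hkl
    exact if_neg this.not_ge

/-- A linear form vanishing to order `μ` forces the Wronskian to vanish to order
`μ - (m - 1)`. -/
lemma le_analyticOrderAt_det_wronskianMatrix {m : ℕ} {f : Fin m → ℂ → ℂ}
    (hf : ∀ i, Differentiable ℂ (f i)) {a : Fin m → ℂ} (ha : a ≠ 0) {z : ℂ} {μ : ℕ}
    (hμ : (μ : ℕ∞) ≤ analyticOrderAt (fun w ↦ ∑ i, a i * f i w) z) :
    ((μ - (m - 1) : ℕ) : ℕ∞) ≤ analyticOrderAt (fun w ↦ (wronskianMatrix f w).det) z := by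
  obtain ⟨i₀, hi₀⟩ := Function.ne_iff.1 ha
  set F : ℂ → ℂ := fun w ↦ ∑ i, a i * f i w with hF
  have hFd : Differentiable ℂ F := Differentiable.fun_sum fun i _ ↦ (hf i).const_mul _
  have hW : (fun w ↦ (wronskianMatrix f w).det) =
      fun w ↦ ∑ k : Fin m, ((a i₀)⁻¹ * (wronskianMatrix f w).adjugate i₀ k) *
        iteratedDeriv k F w := by
    funext w
    have h1 : ((wronskianMatrix f w).adjugate.mulVec ((wronskianMatrix f w).mulVec a)) i₀ =
        (wronskianMatrix f w).det * a i₀ := by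
      rw [Matrix.mulVec_mulVec, Matrix.adjugate_mul, Matrix.smul_mulVec, Matrix.one_mulVec]
      simp
    have h2 : (wronskianMatrix f w).mulVec a = fun k : Fin m ↦ iteratedDeriv k F w := by
      funext k
      rw [hF, iteratedDeriv_sum_const_mul hf]
      simp [Matrix.mulVec, dotProduct, wronskianMatrix, mul_comm]
    rw [h2] at h1
    have hi : a i₀ ≠ 0 := hi₀
    rw [← mul_left_inj' hi, ← h1, Finset.sum_mul]
    simp only [Matrix.mulVec, dotProduct]
    refine Finset.sum_congr rfl fun k _ ↦ ?_
    field_simp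
  rw [hW]
  refine le_analyticOrderAt_sum _ fun k _ ↦ le_analyticOrderAt_mul_right
    (((Differentiable.matrix_adjugate (differentiable_wronskianMatrix hf) i₀ k).const_mul
      _).analyticAt z) ((hFd.iteratedDeriv_complex k).analyticAt z) ?_
  rw [natCast_le_analyticOrderAt_iff_iteratedDeriv_eq_zero
    ((hFd.iteratedDeriv_complex k).analyticAt z)]
  rw [natCast_le_analyticOrderAt_iff_iteratedDeriv_eq_zero (hFd.analyticAt z)] at hμ
  intro j hj
  have hk := k.2
  have := hμ (j + k) (by omega)
  rw [iteratedDeriv_eq_iterate, Function.iterate_add_apply] at this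
  rwa [iteratedDeriv_eq_iterate, iteratedDeriv_eq_iterate]

lemma GenPos.linearIndependent_comp {n q : ℕ} {H : Fin q → Fin (n + 1) → ℂ} (hH : GenPos n q H)
    {e : Fin (n + 1) → Fin q} (he : Function.Injective e) : LinearIndependent ℂ (H ∘ e) := by
  have hs := hH (Finset.univ.map ⟨e, he⟩) (by simp)
  exact hs.comp (fun a ↦ ⟨e a, by simp⟩) fun a b hab ↦ he (congrArg Subtype.val hab)

lemma GenPos.det_ne_zero {n q : ℕ} {H : Fin q → Fin (n + 1) → ℂ} (hH : GenPos n q H)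
    {e : Fin (n + 1) → Fin q} (he : Function.Injective e) :
    (Matrix.of (H ∘ e)).det ≠ 0 := by
  have h : LinearIndependent ℂ (Matrix.of (H ∘ e)).row := hH.linearIndependent_comp he
  rw [Matrix.linearIndependent_rows_iff_isUnit, Matrix.isUnit_iff_isUnit_det] at h
  exact h.ne_zero

lemma Matrix.exists_norm_le_mul_norm_mulVec {m : ℕ} {M : Matrix (Fin m) (Fin m) ℂ}
    (hM : M.det ≠ 0) : ∃ K : ℝ, 0 < K ∧ ∀ w, ‖w‖ ≤ K * ‖M.mulVec w‖ := by
  obtain ⟨K, hK, h⟩ := (Matrix.mulVecLin M⁻¹).toContinuousLinearMap.bound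
  refine ⟨K, hK, fun w ↦ ?_⟩
  have := h (M.mulVec w)
  simpa [Matrix.mulVec_mulVec, Matrix.nonsing_inv_mul _ hM.isUnit] using this

/-- For hyperplanes in general position, all but `n + 1` of the linear forms are comparable to
the norm at any given point. -/
lemma GenPos.exists_norm_le {n : ℕ} {H : Fin (2 * n + 2) → Fin (n + 1) → ℂ}
    (hH : GenPos n (2 * n + 2) H) :
    ∃ K : ℝ, 0 < K ∧ ∀ w : Fin (n + 1) → ℂ, ∃ e : Fin (n + 1) → Fin (2 * n + 2),
      Function.Injective e ∧ ∀ j ∉ Finset.univ.image e, ‖w‖ ≤ K * ‖∑ i, H j i * w i‖ := by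
  classical
  have hex : ∀ e : Fin (n + 1) → Fin (2 * n + 2), ∃ K : ℝ, 0 < K ∧
      (Function.Injective e → ∀ w, ‖w‖ ≤ K * ‖(Matrix.of (H ∘ e)).mulVec w‖) := by
    intro e
    by_cases he : Function.Injective e
    · obtain ⟨K, hK, h⟩ := Matrix.exists_norm_le_mul_norm_mulVec (hH.det_ne_zero he)
      exact ⟨K, hK, fun _ ↦ h⟩
    · exact ⟨1, one_pos, fun h ↦ absurd h he⟩
  choose K hK h using hex
  have hne : (Finset.univ : Finset (Fin (n + 1) → Fin (2 * n + 2))).Nonempty :=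
    ⟨fun _ ↦ 0, Finset.mem_univ _⟩
  have hS : 0 < ∑ e, K e := Finset.sum_pos (fun e _ ↦ hK e) hne
  refine ⟨∑ e, K e, hS, fun w ↦ ?_⟩
  let J : Finset (Fin (2 * n + 2)) :=
    Finset.univ.filter fun j ↦ (∑ e, K e) * ‖∑ i, H j i * w i‖ < ‖w‖
  have hJ : J.card ≤ n + 1 := by
    by_contra! hlt
    obtain ⟨t, ht, htc⟩ := Finset.exists_subset_card_eq hlt.le
    let e : Fin (n + 1) → Fin (2 * n + 2) := t.orderEmbOfFin htc
    have he : Function.Injective e := (t.orderEmbOfFin htc).injective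
    have hmem : ∀ a, (∑ e, K e) * ‖∑ i, H (e a) i * w i‖ < ‖w‖ := fun a ↦
      (Finset.mem_filter.1 (ht (t.orderEmbOfFin_mem htc a))).2
    have hw : 0 < ‖w‖ := (mul_nonneg hS.le (norm_nonneg _)).trans_lt (hmem 0)
    have hlt' : ‖(Matrix.of (H ∘ e)).mulVec w‖ < ‖w‖ / ∑ e, K e := by
      rw [pi_norm_lt_iff (by positivity)]
      intro a
      rw [lt_div_iff₀' hS]
      exact hmem a
    have h1 := h e he w
    have h2 : K e ≤ ∑ e, K e := Finset.single_le_sum (fun e _ ↦ (hK e).le) (Finset.mem_univ e)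
    rw [lt_div_iff₀' hS] at hlt'
    have := mul_le_mul_of_nonneg_right h2 (norm_nonneg ((Matrix.of (H ∘ e)).mulVec w))
    linarith
  obtain ⟨t, ht, htc⟩ := Finset.exists_superset_card_eq hJ (by simp; omega)
  refine ⟨t.orderEmbOfFin htc, (t.orderEmbOfFin htc).injective, fun j hj ↦ ?_⟩
  rw [Finset.image_orderEmbOfFin_univ] at hj
  by_contra! hlt
  exact hj (ht (Finset.mem_filter.2 ⟨Finset.mem_univ _, hlt⟩))

lemma exists_norm_lform_le {n q : ℕ} (H : Fin q → Fin (n + 1) → ℂ) :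
    ∃ C : ℝ, 1 ≤ C ∧ ∀ j, ∀ w : Fin (n + 1) → ℂ, ‖∑ i, H j i * w i‖ ≤ C * ‖w‖ := by
  refine ⟨1 + ∑ j, ∑ i, ‖H j i‖, le_add_of_nonneg_right (by positivity), fun j w ↦ ?_⟩
  have h1 : ∑ i, ‖H j i‖ ≤ ∑ j, ∑ i, ‖H j i‖ :=
    Finset.single_le_sum (f := fun j ↦ ∑ i, ‖H j i‖) (fun _ _ ↦ by positivity) (Finset.mem_univ j)
  calc ‖∑ i, H j i * w i‖ ≤ ∑ i, ‖H j i‖ * ‖w‖ := by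
        refine norm_sum_le_of_le _ fun i _ ↦ ?_
        rw [norm_mul]
        exact mul_le_mul_of_nonneg_left (norm_le_pi_norm w i) (norm_nonneg _)
    _ = (∑ i, ‖H j i‖) * ‖w‖ := by rw [Finset.sum_mul]
    _ ≤ _ := mul_le_mul_of_nonneg_right (by linarith) (norm_nonneg _)

lemma differentiable_lform {n : ℕ} {f : Fin (n + 1) → ℂ → ℂ} (hf : ∀ i, Differentiable ℂ (f i))
    (a : Fin (n + 1) → ℂ) : Differentiable ℂ (lform a f) :=
  Differentiable.fun_sum fun i _ ↦ (hf i).const_mul _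

lemma wronskianMatrix_lform {n : ℕ} {f : Fin (n + 1) → ℂ → ℂ} (hf : ∀ i, Differentiable ℂ (f i))
    (b : Fin (n + 1) → Fin (n + 1) → ℂ) (z : ℂ) :
    wronskianMatrix (fun a ↦ lform (b a) f) z = wronskianMatrix f z * (Matrix.of b).transpose := by
  ext k a
  have := iteratedDeriv_sum_const_mul hf (b a) k z
  simp only [wronskianMatrix, Matrix.of_apply, Matrix.mul_apply, Matrix.transpose_apply]
  rw [show lform (b a) f = fun w ↦ ∑ i, b a i * f i w from rfl, this]
  exact Finset.sum_congr rfl fun i _ ↦ mul_comm _ _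

lemma Matrix.norm_det_le_prod {m : ℕ} {M : Matrix (Fin m) (Fin m) ℂ} {b : Fin m → ℝ}
    (h : ∀ i j, ‖M i j‖ ≤ b j) : ‖M.det‖ ≤ m.factorial * ∏ j, b j := by
  rw [Matrix.det_apply]
  have : ∀ σ ∈ (Finset.univ : Finset (Equiv.Perm (Fin m))),
      ‖Equiv.Perm.sign σ • ∏ i, M (σ i) i‖ ≤ ∏ j, b j := by
    intro σ _
    have h1 : ‖Equiv.Perm.sign σ • ∏ i, M (σ i) i‖ = ∏ i, ‖M (σ i) i‖ := by
      rcases Int.units_eq_one_or (Equiv.Perm.sign σ) with h | h <;> simp [h]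
    rw [h1]
    exact Finset.prod_le_prod (fun _ _ ↦ norm_nonneg _) fun i _ ↦ h _ _
  refine (norm_sum_le_of_le _ this).trans ?_
  simp [Fintype.card_perm]

/-- The quotient `W · (f, L)ⁿ / ∏ (f, H_j)`, where `W` is the Wronskian. -/
def wronskianQuotient {n : ℕ} (H : Fin (2 * n + 2) → Fin (n + 1) → ℂ) (L : Fin (n + 1) → ℂ)
    (f : Fin (n + 1) → ℂ → ℂ) (z : ℂ) : ℂ :=
  (wronskianMatrix f z).det * lform L f z ^ n / ∏ j, lform (H j) f z

/-- Pointwise bound for the Wronskian quotient away from the zeros of the linear forms. -/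
lemma exists_norm_wronskianQuotient_mul_norm_le {n : ℕ} {H : Fin (2 * n + 2) → Fin (n + 1) → ℂ}
    (hH : GenPos n (2 * n + 2) H) (L : Fin (n + 1) → ℂ) :
    ∃ D : ℝ, 0 < D ∧ ∀ (h : Fin (n + 1) → ℂ → ℂ) (z : ℂ) (s C : ℝ),
      (∀ i, Differentiable ℂ (h i)) → 1 ≤ s → (∃ i, h i z ≠ 0) →
      (∀ j, ∀ w ∈ ball z (s ^ 2)⁻¹, lform (H j) h w ≠ 0) →
      (∀ j, ∀ w ∈ ball z (s ^ 2)⁻¹, ‖lform (H j) h w‖ ≤ C) →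
      ‖wronskianQuotient H L h z‖ * ‖fun i ↦ h i z‖ ≤
        D * s ^ (2 * n * (n + 1)) *
          ∏ j, (1 + (Real.log C - Real.log ‖lform (H j) h z‖)) ^ n := by
  classical
  obtain ⟨K, hK, hsel⟩ := hH.exists_norm_le
  obtain ⟨CL, hCL, hL⟩ := exists_norm_lform_le (q := 1) fun _ ↦ L
  have hdet : ∃ d : ℝ, 0 < d ∧ ∀ e : Fin (n + 1) → Fin (2 * n + 2), Function.Injective e →
      1 ≤ d * ‖(Matrix.of (H ∘ e)).det‖ := by
    have hne : ∀ e : Fin (n + 1) → Fin (2 * n + 2), ∃ d : ℝ, 0 < d ∧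
        (Function.Injective e → 1 ≤ d * ‖(Matrix.of (H ∘ e)).det‖) := by
      intro e
      by_cases he : Function.Injective e
      · have := norm_pos_iff.2 (hH.det_ne_zero he)
        exact ⟨‖(Matrix.of (H ∘ e)).det‖⁻¹, by positivity, fun _ ↦ (inv_mul_cancel₀ this.ne').ge⟩
      · exact ⟨1, one_pos, fun h ↦ absurd h he⟩
    choose d hd h using hne
    refine ⟨∑ e, d e, Finset.sum_pos (fun e _ ↦ hd e) ⟨fun _ ↦ 0, Finset.mem_univ _⟩,
      fun e he ↦ (h e he).trans ?_⟩
    exact mul_le_mul_of_nonneg_right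
      (Finset.single_le_sum (fun e _ ↦ (hd e).le) (Finset.mem_univ e)) (norm_nonneg _)
  obtain ⟨d, hd, hdet⟩ := hdet
  set E : ℝ := n.factorial * Real.exp 2 * 4 ^ n with hE
  have hE0 : 0 < E := by positivity
  refine ⟨d * ((n + 1).factorial * E ^ (n + 1)) * CL ^ n * K ^ (n + 1), by positivity, ?_⟩
  intro h z s C hh hs hz h0 hC
  have hs0 : 0 < s := by linarith
  set δ := (s ^ 2)⁻¹ with hδ
  have hδ0 : 0 < δ := by positivity
  set F : Fin (2 * n + 2) → ℂ → ℂ := fun j ↦ lform (H j) h with hF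
  have hFd : ∀ j, Differentiable ℂ (F j) := fun j ↦ differentiable_lform hh _
  have hFz : ∀ j, 0 < ‖F j z‖ := fun j ↦ norm_pos_iff.2 (h0 j z (mem_ball_self hδ0))
  set w : Fin (n + 1) → ℂ := fun i ↦ h i z with hw
  have hw0 : 0 < ‖w‖ := by
    obtain ⟨i, hi⟩ := hz
    exact norm_pos_iff.2 (Function.ne_iff.2 ⟨i, hi⟩)
  set m : Fin (2 * n + 2) → ℝ := fun j ↦ 1 + (Real.log C - Real.log ‖F j z‖) with hm
  have hm1 : ∀ j, 1 ≤ m j := fun j ↦ by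
    have := Real.log_le_log (hFz j) (hC j z (mem_ball_self hδ0))
    simp only [hm]; linarith
  have hm0 : ∀ j, 0 ≤ m j := fun j ↦ zero_le_one.trans (hm1 j)
  obtain ⟨e, he, hsel⟩ := hsel w
  have hentry : ∀ k a, ‖wronskianMatrix (fun a ↦ F (e a)) z k a‖ ≤
      E * (s ^ (2 * n) * m (e a) ^ n) * ‖F (e a) z‖ := by
    intro k a
    have h1 := norm_iteratedDeriv_le_of_ne_zero_on_ball hδ0 (hFd (e a)) (h0 (e a)) (hC (e a)) k
    have hk : (k : ℕ) ≤ n := Nat.lt_succ_iff.1 k.2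
    have hCpos : 0 < C := (hFz (e a)).trans_le (hC (e a) z (mem_ball_self hδ0))
    rw [Real.log_div hCpos.ne' (hFz (e a)).ne'] at h1
    change _ ≤ (k : ℕ).factorial * Real.exp 2 * (4 * m (e a) / δ) ^ (k : ℕ) * ‖F (e a) z‖ at h1
    refine h1.trans (mul_le_mul_of_nonneg_right ?_ (norm_nonneg _))
    have h2 : 4 * m (e a) / δ = 4 * (s ^ 2 * m (e a)) := by rw [hδ]; field_simp
    have hx : 1 ≤ s ^ 2 * m (e a) := one_le_mul_of_one_le_of_one_le (one_le_pow₀ hs) (hm1 _)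
    have h3 : (4 * m (e a) / δ) ^ (k : ℕ) ≤ (4 * (s ^ 2 * m (e a))) ^ n := by
      rw [h2]
      exact pow_le_pow_right₀ (by linarith) hk
    have h4 : ((k : ℕ).factorial : ℝ) ≤ n.factorial := by exact_mod_cast Nat.factorial_le hk
    calc (k : ℕ).factorial * Real.exp 2 * (4 * m (e a) / δ) ^ (k : ℕ)
        ≤ n.factorial * Real.exp 2 * (4 * (s ^ 2 * m (e a))) ^ n := by
          have : 0 ≤ 4 * m (e a) / δ := by rw [h2]; linarith
          gcongr
      _ = _ := by rw [hE, mul_pow, mul_pow, ← pow_mul]; ring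
  have hWe : ‖(wronskianMatrix h z).det‖ * ‖(Matrix.of (H ∘ e)).det‖ ≤
      (n + 1).factorial * (E ^ (n + 1) * s ^ (2 * n * (n + 1)) * ∏ j, m j ^ n) *
        ∏ a, ‖F (e a) z‖ := by
    have h1 := Matrix.norm_det_le_prod hentry
    have h2 := wronskianMatrix_lform hh (H ∘ e) z
    change wronskianMatrix (fun a ↦ F (e a)) z = _ at h2
    rw [h2, Matrix.det_mul, Matrix.det_transpose, norm_mul] at h1
    refine h1.trans ?_
    have h3 : ∏ a, m (e a) ^ n ≤ ∏ j, m j ^ n := by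
      rw [← Finset.prod_image (s := Finset.univ) (g := e) (f := fun j ↦ m j ^ n)
        (fun a _ b _ hab ↦ he hab),
        ← Finset.prod_mul_prod_compl (Finset.univ.image e) fun j ↦ m j ^ n]
      exact le_mul_of_one_le_right (Finset.prod_nonneg fun j _ ↦ pow_nonneg (hm0 j) n)
        (Finset.prod_induction _ (fun x ↦ 1 ≤ x) (fun _ _ ↦ one_le_mul_of_one_le_of_one_le)
          le_rfl fun j _ ↦ one_le_pow₀ (hm1 j))
    have h4 : ∏ a, E * (s ^ (2 * n) * m (e a) ^ n) * ‖F (e a) z‖ =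
        (E ^ (n + 1) * s ^ (2 * n * (n + 1)) * ∏ a, m (e a) ^ n) * ∏ a, ‖F (e a) z‖ := by
      simp only [Finset.prod_mul_distrib, Finset.prod_const, Finset.card_univ, Fintype.card_fin,
        ← pow_mul]
      ring
    rw [h4, ← mul_assoc]
    gcongr
  have hprod : (∏ a, ‖F (e a) z‖) * ‖w‖ ^ (n + 1) ≤ K ^ (n + 1) * ∏ j, ‖F j z‖ := by
    rw [← Finset.prod_mul_prod_compl (Finset.univ.image e) fun j ↦ ‖F j z‖,
      Finset.prod_image fun a _ b _ hab ↦ he hab, mul_left_comm]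
    refine mul_le_mul_of_nonneg_left ?_ (by positivity)
    have hcard : (Finset.univ.image e)ᶜ.card = n + 1 := by
      rw [Finset.card_compl, Finset.card_image_of_injective _ he]
      simp; omega
    calc ‖w‖ ^ (n + 1) = ∏ _j ∈ (Finset.univ.image e)ᶜ, ‖w‖ := by rw [Finset.prod_const, hcard]
      _ ≤ ∏ j ∈ (Finset.univ.image e)ᶜ, K * ‖F j z‖ :=
        Finset.prod_le_prod (fun _ _ ↦ norm_nonneg _) fun j hj ↦ hsel j (Finset.mem_compl.1 hj)
      _ = _ := by rw [Finset.prod_mul_distrib, Finset.prod_const, hcard]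
  have hLz : ‖lform L h z‖ ^ n ≤ CL ^ n * ‖w‖ ^ n := by
    rw [← mul_pow]
    exact pow_le_pow_left₀ (norm_nonneg _) (hL 0 w) n
  have hP : 0 < ∏ j, ‖F j z‖ := Finset.prod_pos fun j _ ↦ hFz j
  have hW : ‖(wronskianMatrix h z).det‖ ≤ d * ((n + 1).factorial * (E ^ (n + 1) *
      s ^ (2 * n * (n + 1)) * ∏ j, m j ^ n) * ∏ a, ‖F (e a) z‖) := by
    have h1 := mul_le_mul_of_nonneg_left (hdet e he) (norm_nonneg (wronskianMatrix h z).det)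
    have h2 := mul_le_mul_of_nonneg_left hWe hd.le
    linarith
  have hm0' : 0 ≤ ∏ j, m j ^ n := Finset.prod_nonneg fun j _ ↦ pow_nonneg (hm0 j) n
  rw [wronskianQuotient, norm_div, norm_mul, norm_pow, norm_prod, div_mul_eq_mul_div,
    div_le_iff₀ hP]
  calc ‖(wronskianMatrix h z).det‖ * ‖lform L h z‖ ^ n * ‖w‖
      ≤ d * ((n + 1).factorial * (E ^ (n + 1) *
      s ^ (2 * n * (n + 1)) * ∏ j, m j ^ n) * ∏ a, ‖F (e a) z‖) * (CL ^ n * ‖w‖ ^ n) * ‖w‖ := by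
        gcongr
    _ = d * ((n + 1).factorial * (E ^ (n + 1) *
      s ^ (2 * n * (n + 1)) * ∏ j, m j ^ n)) * CL ^ n *
        ((∏ a, ‖F (e a) z‖) * ‖w‖ ^ (n + 1)) := by ring
    _ ≤ d * ((n + 1).factorial * (E ^ (n + 1) *
      s ^ (2 * n * (n + 1)) * ∏ j, m j ^ n)) * CL ^ n * (K ^ (n + 1) * ∏ j, ‖F j z‖) := by
        gcongr
    _ = _ := by ring

lemma meromorphicOrderAt_div_nonneg {u d : ℂ → ℂ} {z : ℂ} (hu : AnalyticAt ℂ u z)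
    (hd : AnalyticAt ℂ d z) (h : analyticOrderAt d z ≤ analyticOrderAt u z) :
    0 ≤ meromorphicOrderAt (u / d) z := by
  by_cases htop : analyticOrderAt d z = ⊤
  · have h0 : ∀ᶠ w in 𝓝 z, d w = 0 := analyticOrderAt_eq_top.1 htop
    have : meromorphicOrderAt (u / d) z = ⊤ := by
      rw [meromorphicOrderAt_eq_top_iff]
      filter_upwards [h0.filter_mono nhdsWithin_le_nhds] with w hw
      simp [hw]
    simp [this]
  · obtain ⟨k, hk⟩ := ENat.ne_top_iff_exists.1 htop
    rw [div_eq_mul_inv, meromorphicOrderAt_mul hu.meromorphicAt hd.meromorphicAt.inv,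
      meromorphicOrderAt_inv, hu.meromorphicOrderAt_eq, hd.meromorphicOrderAt_eq]
    rw [← hk] at h ⊢
    by_cases hutop : analyticOrderAt u z = ⊤
    · simp [hutop]
    · obtain ⟨l, hl⟩ := ENat.ne_top_iff_exists.1 hutop
      rw [← hl] at h ⊢
      have : k ≤ l := by exact_mod_cast h
      simp only [ENat.map_natCast]
      have h2 : (0 : ℤ) ≤ (l : ℤ) + -(k : ℤ) := by omega
      exact_mod_cast h2

/-- The Wronskian quotient has no poles when the zero sets of the forms `(f, H_j)` are disjoint
and `(f, L)` vanishes on all of them. -/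
lemma meromorphicOrderAt_wronskianQuotient_nonneg {n : ℕ} (hn : 1 ≤ n)
    {H : Fin (2 * n + 2) → Fin (n + 1) → ℂ} (hH0 : ∀ j, H j ≠ 0) {L : Fin (n + 1) → ℂ}
    {f : Fin (n + 1) → ℂ → ℂ} (hf : ∀ i, Differentiable ℂ (f i)) (hF : ∀ j, lform (H j) f ≠ 0)
    (hdisj : ∀ i j, i ≠ j → ∀ z, lform (H i) f z = 0 → lform (H j) f z ≠ 0)
    (hL : ∀ j z, lform (H j) f z = 0 → lform L f z = 0) (z : ℂ) :
    0 ≤ meromorphicOrderAt (wronskianQuotient H L f) z := by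
  classical
  have hFd : ∀ a, Differentiable ℂ (lform a f) := differentiable_lform hf
  have hWd : Differentiable ℂ fun w ↦ (wronskianMatrix f w).det :=
    Differentiable.matrix_det (differentiable_wronskianMatrix hf)
  set W : ℂ → ℂ := fun w ↦ (wronskianMatrix f w).det with hW
  have hu : Differentiable ℂ fun w ↦ W w * lform L f w ^ n := hWd.mul ((hFd L).pow n)
  have hdprod : ∀ s : Finset (Fin (2 * n + 2)), Differentiable ℂ fun w ↦ ∏ j ∈ s, lform (H j) f w :=
    fun s ↦ Differentiable.fun_finsetProd fun j _ ↦ hFd _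
  refine meromorphicOrderAt_div_nonneg (hu.analyticAt z) ((hdprod _).analyticAt z) ?_
  by_cases hz : ∃ j, lform (H j) f z = 0
  · obtain ⟨j, hj⟩ := hz
    have h1 : (fun w ↦ ∏ i, lform (H i) f w) =
        lform (H j) f * fun w ↦ ∏ i ∈ Finset.univ.erase j, lform (H i) f w := by
      funext w
      exact (Finset.mul_prod_erase _ _ (Finset.mem_univ j)).symm
    have h2 : analyticOrderAt (fun w ↦ ∏ i ∈ Finset.univ.erase j, lform (H i) f w) z = 0 := by
      rw [((hdprod _).analyticAt z).analyticOrderAt_eq_zero]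
      exact Finset.prod_ne_zero_iff.2 fun i hi ↦ hdisj j i (Finset.ne_of_mem_erase hi).symm z hj
    rw [h1, analyticOrderAt_mul ((hFd _).analyticAt z) ((hdprod _).analyticAt z), h2, add_zero]
    have htop : analyticOrderAt (lform (H j) f) z ≠ ⊤ := fun h ↦
      hF j ((AnalyticOnNhd.analyticOrderAt_eq_top_iff_eq_zero z (fun w ↦ (hFd _).analyticAt w)).1 h)
    obtain ⟨μ, hμ⟩ := ENat.ne_top_iff_exists.1 htop
    have hWo := le_analyticOrderAt_det_wronskianMatrix hf (hH0 j) (z := z) (μ := μ) hμ.le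
    have hLo : ((n : ℕ) : ℕ∞) ≤ analyticOrderAt (lform L f ^ n) z := by
      rw [analyticOrderAt_pow ((hFd L).analyticAt z)]
      have h3 : 1 ≤ analyticOrderAt (lform L f) z :=
        Order.one_le_iff_ne_zero.2 fun h ↦
          ((hFd L).analyticAt z).analyticOrderAt_eq_zero.1 h (hL j z hj)
      simpa using nsmul_le_nsmul_right h3 n
    change _ ≤ analyticOrderAt (W * lform L f ^ n) z
    rw [analyticOrderAt_mul (hWd.analyticAt z) (((hFd L).analyticAt z).pow n), ← hμ]
    refine le_trans ?_ (add_le_add hWo hLo)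
    have : μ ≤ μ - (n + 1 - 1) + n := by omega
    exact_mod_cast this
  · push Not at hz
    have : analyticOrderAt (fun w ↦ ∏ i, lform (H i) f w) z = 0 := by
      rw [((hdprod _).analyticAt z).analyticOrderAt_eq_zero]
      exact Finset.prod_ne_zero_iff.2 fun i _ ↦ hz i
    rw [this]
    exact zero_le

lemma exists_finset_zeros_card_mul_le {ι : Type*} [Fintype ι] {F : ι → ℂ → ℂ}
    (hF : ∀ j, Differentiable ℂ (F j)) {c : ℂ} {r τ M A : ℝ} (hr : 0 < r) (hτ : 0 < τ) (hτ1 : τ ≤ 1)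
    (hM : 1 ≤ M) (hc : ∀ j, F j c ≠ 0)
    (hb : ∀ j, ∀ z ∈ sphere c (r * (1 + 2 * τ)), ‖F j z‖ ≤ M)
    (hA : ∀ j, Real.log M - Real.log ‖F j c‖ ≤ A) :
    ∃ Z : Finset ℂ, (∀ j, ∀ z ∈ closedBall c (r * (1 + τ)), F j z = 0 → z ∈ Z) ∧
      Z.card * τ ≤ Fintype.card ι * (3 * A) := by
  classical
  have hlt : r * (1 + τ) < r * (1 + 2 * τ) := by nlinarith
  choose Z hZ hcard using fun j ↦
    card_zeros_mul_log_le (hF j) (by positivity) hlt hM (hc j) (hb j)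
  refine ⟨Finset.univ.biUnion Z, fun j z hz h0 ↦
    Finset.mem_biUnion.2 ⟨j, Finset.mem_univ _, hZ j z hz h0⟩, ?_⟩
  have hlog : τ / 3 ≤ Real.log (r * (1 + 2 * τ) / (r * (1 + τ))) := by
    refine le_trans ?_ (Real.one_sub_inv_le_log_of_pos (by positivity))
    rw [inv_div, mul_div_mul_left _ _ hr.ne', div_le_iff₀ (by norm_num)]
    have : 1 - (1 + τ) / (1 + 2 * τ) = τ / (1 + 2 * τ) := by field_simp; ring
    rw [this, div_mul_eq_mul_div, le_div_iff₀ (by positivity)]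
    nlinarith
  have hj : ∀ j, ((Z j).card : ℝ) * τ ≤ 3 * A := fun j ↦ by
    have h1 := hcard j
    rw [Real.log_div (by positivity) (norm_ne_zero_iff.2 (hc j))] at h1
    have h2 := mul_le_mul_of_nonneg_left hlog ((Z j).card.cast_nonneg (α := ℝ))
    have := hA j
    linarith
  calc ((Finset.univ.biUnion Z).card : ℝ) * τ ≤ (∑ j, ((Z j).card : ℝ)) * τ := by
        refine mul_le_mul_of_nonneg_right ?_ hτ.le
        exact_mod_cast Finset.card_biUnion_le
    _ ≤ ∑ _j : ι, 3 * A := by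
        rw [Finset.sum_mul]
        exact Finset.sum_le_sum fun j _ ↦ hj j
    _ = _ := by simp

/-- Logarithmic form of the pointwise bound for the Wronskian quotient, valid at all points. -/
lemma exists_log_norm_wronskianQuotient_add_log_norm_le {n : ℕ}
    {H : Fin (2 * n + 2) → Fin (n + 1) → ℂ}
    (hH : GenPos n (2 * n + 2) H) (L : Fin (n + 1) → ℂ) :
    ∃ D : ℝ, 0 < D ∧ ∀ (h : Fin (n + 1) → ℂ → ℂ) (z : ℂ) (s C : ℝ),
      (∀ i, Differentiable ℂ (h i)) → 1 ≤ s → (∃ i, h i z ≠ 0) → 1 ≤ C →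
      ‖fun i ↦ h i z‖ ≤ Real.exp 1 →
      (∀ j, ∀ w ∈ ball z (s ^ 2)⁻¹, w ≠ z → lform (H j) h w ≠ 0) →
      (∀ j, ∀ w ∈ ball z (s ^ 2)⁻¹, ‖lform (H j) h w‖ ≤ C) →
      Real.log ‖wronskianQuotient H L h z‖ + Real.log ‖fun i ↦ h i z‖ ≤
        D + (2 * n * (n + 1) : ℕ) * Real.log s +
          n * ∑ j, Real.log (1 + (Real.log C - Real.log ‖lform (H j) h z‖)) := by
  obtain ⟨D, hD, key⟩ := exists_norm_wronskianQuotient_mul_norm_le hH L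
  refine ⟨max (Real.log D) 1, lt_max_of_lt_right one_pos, ?_⟩
  intro h z s C hh hs hz hC1 hexp h0 hC
  have hs0 : 0 < s := by linarith
  have hzb : z ∈ ball z (s ^ 2)⁻¹ := mem_ball_self (by positivity)
  have hm1 : ∀ j, 1 ≤ 1 + (Real.log C - Real.log ‖lform (H j) h z‖) := fun j ↦ by
    rcases eq_or_ne (lform (H j) h z) 0 with h1 | h1
    · simp [h1, Real.log_nonneg hC1]
    · have := Real.log_le_log (norm_pos_iff.2 h1) (hC j z hzb)
      linarith
  have hlogm : 0 ≤ ∑ j, Real.log (1 + (Real.log C - Real.log ‖lform (H j) h z‖)) :=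
    Finset.sum_nonneg fun j _ ↦ Real.log_nonneg (hm1 j)
  have hw0 : 0 < ‖fun i ↦ h i z‖ := by
    obtain ⟨i, hi⟩ := hz
    exact norm_pos_iff.2 (Function.ne_iff.2 ⟨i, hi⟩)
  by_cases hΦ : wronskianQuotient H L h z = 0
  · have h1 : Real.log ‖fun i ↦ h i z‖ ≤ 1 := by
      rw [← Real.log_exp 1]
      exact Real.log_le_log hw0 hexp
    have h2 := Real.log_nonneg hs
    rw [hΦ, norm_zero, Real.log_zero, zero_add]
    have := le_max_right (Real.log D) 1
    have h3 : 0 ≤ ((2 * n * (n + 1) : ℕ) : ℝ) * Real.log s := by positivity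
    have h4 := mul_nonneg (n.cast_nonneg (α := ℝ)) hlogm
    linarith
  · have h0' : ∀ j, ∀ w ∈ ball z (s ^ 2)⁻¹, lform (H j) h w ≠ 0 := by
      intro j w hw
      rcases eq_or_ne w z with rfl | hwz
      · intro hzero
        refine hΦ ?_
        rw [wronskianQuotient, Finset.prod_eq_zero (Finset.mem_univ j) hzero, div_zero]
      · exact h0 j w hw hwz
    have h1 := key h z s C hh hs hz h0' hC
    have h2 : 0 < ‖wronskianQuotient H L h z‖ := norm_pos_iff.2 hΦ
    have h3 := Real.log_le_log (by positivity) h1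
    have hm0 : ∀ j, 1 + (Real.log C - Real.log ‖lform (H j) h z‖) ≠ 0 := fun j ↦ by
      linarith [hm1 j]
    rw [Real.log_mul h2.ne' hw0.ne', Real.log_mul (by positivity)
      (Finset.prod_ne_zero_iff.2 fun j _ ↦ pow_ne_zero _ (hm0 j)),
      Real.log_mul hD.ne' (by positivity), Real.log_pow,
      Real.log_prod (fun j _ ↦ pow_ne_zero _ (hm0 j))] at h3
    simp only [Real.log_pow, ← Finset.mul_sum] at h3
    have := le_max_left (Real.log D) 1
    linarith

lemma log_le_log_add_div {x a : ℝ} (hx : 0 < x) (ha : 0 < a) : Real.log x ≤ Real.log a + x / a := by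
  have := Real.log_le_sub_one_of_pos (div_pos hx ha)
  rw [Real.log_div hx.ne' ha.ne'] at this
  linarith

/-- Integrated bound for the Wronskian quotient of a map that is normalised on a disc. -/
theorem exists_log_wronskianQuotient_add_circleAverage_le {n : ℕ} (hn : 1 ≤ n)
    {H : Fin (2 * n + 2) → Fin (n + 1) → ℂ} (hH : GenPos n (2 * n + 2) H) (L : Fin (n + 1) → ℂ) :
    ∃ B D : ℝ, 0 ≤ D ∧ ∀ (h : Fin (n + 1) → ℂ → ℂ) (c : ℂ) (r τ A : ℝ),
      (∀ i, Differentiable ℂ (h i)) → (∀ z, ∃ i, h i z ≠ 0) →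
      (∀ i j, i ≠ j → ∀ z, lform (H i) h z = 0 → lform (H j) h z ≠ 0) →
      (∀ j z, lform (H j) h z = 0 → lform L h z = 0) →
      wronskianQuotient H L h c ≠ 0 → 1 ≤ r → 0 < τ → τ ≤ 1 →
      (∀ z ∈ closedBall c (r * (1 + 2 * τ)), ‖fun i ↦ h i z‖ ≤ Real.exp 1) → 1 ≤ A →
      (∀ j, B - Real.log ‖lform (H j) h c‖ ≤ A) →
      Real.log ‖wronskianQuotient H L h c‖ +
          circleAverage (fun z ↦ Real.log ‖fun i ↦ h i z‖) c r ≤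
        D * (1 + Real.log A + Real.log (1 / τ)) := by
  obtain ⟨d, hd, key⟩ := exists_log_norm_wronskianQuotient_add_log_norm_le hH L
  obtain ⟨CH, hCH, hHb⟩ := exists_norm_lform_le H
  obtain ⟨K, hK, hKavg⟩ := exists_circleAverage_inv_sqrt_norm_sub_le
  set C := CH * Real.exp 1 with hC
  have hC1 : 1 ≤ C := one_le_mul_of_one_le_of_one_le hCH (Real.one_le_exp zero_le_one)
  set N : ℝ := ((2 * n * (n + 1) : ℕ) : ℝ) with hN
  have hN0 : 0 ≤ N := by positivity
  set κ : ℝ := 1 + K * (((2 * n + 2 : ℕ) : ℝ) * 3) with hκ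
  have hκ1 : 1 ≤ κ := le_add_of_nonneg_right (by positivity)
  have hκ0 : 0 ≤ Real.log κ := Real.log_nonneg hκ1
  set P : ℝ := n * ((2 * n + 2 : ℕ) : ℝ) with hP
  have hP0 : 0 ≤ P := by positivity
  refine ⟨Real.log C, d + N * (Real.log κ + 1) + N + 2 * P, by positivity, ?_⟩
  intro h c r τ A hh hz hdisj hL hΦ hr hτ hτ1 hnorm hA hAj
  have hr0 : 0 < r := by linarith
  set F : Fin (2 * n + 2) → ℂ → ℂ := fun j ↦ lform (H j) h with hF
  have hFd : ∀ j, Differentiable ℂ (F j) := fun j ↦ differentiable_lform hh _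
  have hFc : ∀ j, F j c ≠ 0 := by
    intro j hj
    exact hΦ (by rw [wronskianQuotient, Finset.prod_eq_zero (Finset.mem_univ j) hj, div_zero])
  have hFC : ∀ j, ∀ z ∈ closedBall c (r * (1 + 2 * τ)), ‖F j z‖ ≤ C := fun j z hz ↦
    (hHb j _).trans (mul_le_mul_of_nonneg_left (hnorm z hz) (by linarith))
  obtain ⟨Z, hZ, hZcard⟩ := exists_finset_zeros_card_mul_le hFd hr0 hτ hτ1 hC1 hFc
    (fun j z hz ↦ hFC j z (sphere_subset_closedBall hz)) hAj
  rw [Fintype.card_fin] at hZcard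
  set s : ℂ → ℝ := fun z ↦ (√τ)⁻¹ + ∑ a ∈ Z, (√‖z - a‖)⁻¹ with hs
  have hsqrt : 1 ≤ (√τ)⁻¹ := (one_le_inv₀ (Real.sqrt_pos.2 hτ)).2 (Real.sqrt_le_one.2 hτ1)
  have hs1 : ∀ z, 1 ≤ s z := fun z ↦ hsqrt.trans (le_add_of_nonneg_right (by positivity))
  set Q : ℝ := κ * (A / τ) with hQ
  have hAτ : 1 ≤ A / τ := (one_le_div hτ).2 (hτ1.trans hA)
  have hQ1 : 1 ≤ Q := one_le_mul_of_one_le_of_one_le hκ1 hAτ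
  set m : Fin (2 * n + 2) → ℂ → ℝ := fun j z ↦ 1 + (Real.log C - Real.log ‖F j z‖) with hm
  have hm1 : ∀ j, ∀ z ∈ sphere c r, 1 ≤ m j z := fun j z hz ↦ by
    rcases eq_or_ne (F j z) 0 with h1 | h1
    · simp [hm, h1, Real.log_nonneg hC1]
    · have := Real.log_le_log (norm_pos_iff.2 h1) (hFC j z
        (closedBall_subset_closedBall (by nlinarith) (sphere_subset_closedBall hz)))
      simp only [hm]; linarith
  have hpoint : ∀ z ∈ sphere c r,
      Real.log ‖wronskianQuotient H L h z‖ + Real.log ‖fun i ↦ h i z‖ ≤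
        (d + N * Real.log Q + P * Real.log A) + ((N / Q) • s z + (n / A : ℝ) • ∑ j, m j z) := by
    intro z hzr
    have hzr' : dist z c = r := hzr
    have hs0 : 0 < s z := by linarith [hs1 z]
    have hball : ball z (s z ^ 2)⁻¹ ⊆ closedBall c (r * (1 + τ)) := by
      intro w hw
      have h1 : (s z ^ 2)⁻¹ ≤ τ := by
        rw [inv_le_comm₀ (by positivity) hτ]
        have h2 : (√τ)⁻¹ ≤ s z := le_add_of_nonneg_right (by positivity)
        calc τ⁻¹ = (√τ)⁻¹ ^ 2 := by rw [inv_pow, Real.sq_sqrt hτ.le]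
          _ ≤ _ := pow_le_pow_left₀ (by positivity) h2 2
      have h2 := dist_triangle w z c
      have h3 : dist w z < (s z ^ 2)⁻¹ := hw
      rw [mem_closedBall]
      nlinarith
    have hsub : closedBall c (r * (1 + τ)) ⊆ closedBall c (r * (1 + 2 * τ)) :=
      closedBall_subset_closedBall (by nlinarith)
    refine (key h z (s z) C hh (hs1 z) (hz z) hC1 (hnorm z ?_) ?_ ?_).trans ?_
    · exact closedBall_subset_closedBall (by nlinarith) (sphere_subset_closedBall hzr)
    · intro j w hw hwz hw0
      have hwZ := hZ j w (hball hw) hw0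
      have h1 : (√‖z - w‖)⁻¹ ≤ s z := by
        have := Finset.single_le_sum (f := fun a ↦ (√‖z - a‖)⁻¹) (fun _ _ ↦ by positivity) hwZ
        have h3 : 0 ≤ (√τ)⁻¹ := by positivity
        simp only [hs]; linarith
      have h2 : 0 < ‖z - w‖ := norm_pos_iff.2 (sub_ne_zero.2 hwz.symm)
      have h3 : ‖z - w‖⁻¹ ≤ s z ^ 2 := by
        calc ‖z - w‖⁻¹ = (√‖z - w‖)⁻¹ ^ 2 := by rw [inv_pow, Real.sq_sqrt h2.le]
          _ ≤ _ := pow_le_pow_left₀ (by positivity) h1 2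
      rw [inv_le_comm₀ h2 (by positivity)] at h3
      have h4 : dist w z < (s z ^ 2)⁻¹ := hw
      rw [dist_comm, dist_eq_norm] at h4
      linarith
    · exact fun j w hw ↦ hFC j w (hsub (hball hw))
    · have h1 := mul_le_mul_of_nonneg_left
        (log_le_log_add_div hs0 (zero_lt_one.trans_le hQ1)) hN0
      have h2 : ∑ j, Real.log (m j z) ≤ ∑ j, (Real.log A + m j z / A) :=
        Finset.sum_le_sum fun j _ ↦ log_le_log_add_div (by linarith [hm1 j z hzr]) (by linarith)
      rw [Finset.sum_add_distrib, ← Finset.sum_div] at h2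
      simp only [Finset.sum_const, Finset.card_univ, Fintype.card_fin, nsmul_eq_mul] at h2
      have h3 := mul_le_mul_of_nonneg_left h2 (n.cast_nonneg (α := ℝ))
      change d + N * Real.log (s z) + n * ∑ j, Real.log (m j z) ≤ _
      rw [smul_eq_mul, smul_eq_mul]
      have h4 : (n : ℝ) * (((2 * n + 2 : ℕ) : ℝ) * Real.log A + (∑ j, m j z) / A) =
        P * Real.log A + n / A * ∑ j, m j z := by rw [hP]; ring
      have h5 : N * (Real.log Q + s z / Q) = N * Real.log Q + N / Q * s z := by ring
      linarith
  have hFan : ∀ j, AnalyticOnNhd ℂ (F j) Set.univ := fun j z _ ↦ (hFd j).analyticAt z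
  have hFmer : ∀ j (S : Set ℂ), MeromorphicOn (F j) S := fun j S z _ ↦
    ((hFd j).analyticAt z).meromorphicAt
  have hWd : Differentiable ℂ fun w ↦ (wronskianMatrix h w).det :=
    Differentiable.matrix_det (differentiable_wronskianMatrix hh)
  have hnum : Differentiable ℂ fun w ↦ (wronskianMatrix h w).det * lform L h w ^ n :=
    hWd.mul ((differentiable_lform hh L).pow n)
  have hden : Differentiable ℂ fun w ↦ ∏ j, F j w :=
    Differentiable.fun_finsetProd fun j _ ↦ hFd j
  have hΦmer : ∀ z, MeromorphicAt (wronskianQuotient H L h) z := fun z ↦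
    (hnum.analyticAt z).meromorphicAt.div (hden.analyticAt z).meromorphicAt
  have hΦan : AnalyticAt ℂ (wronskianQuotient H L h) c :=
    (hnum.analyticAt c).div (hden.analyticAt c) (Finset.prod_ne_zero_iff.2 fun j _ ↦ hFc j)
  have hH0 : ∀ j, H j ≠ 0 := by
    intro j hj
    exact hFc j (by simp [hF, lform, hj])
  have hjΦ := log_norm_le_circleAverage_of_order_nonneg hr0 (fun z _ ↦ hΦmer z)
    (fun z _ ↦ meromorphicOrderAt_wronskianQuotient_nonneg hn hH0 hh
      (fun j hj ↦ hFc j (congrFun hj c)) hdisj hL z) hΦan hΦ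
  have hjF : ∀ j, Real.log ‖F j c‖ ≤ circleAverage (fun z ↦ Real.log ‖F j z‖) c r := fun j ↦
    log_norm_le_circleAverage_of_order_nonneg hr0 (hFmer j _)
      (fun z _ ↦ ((hFd j).analyticAt z).meromorphicOrderAt_nonneg) ((hFd j).analyticAt c) (hFc j)
  have iΦ : CircleIntegrable (fun z ↦ Real.log ‖wronskianQuotient H L h z‖) c r :=
    MeromorphicOn.circleIntegrable_log_norm fun z _ ↦ hΦmer z
  have iF : ∀ j, CircleIntegrable (fun z ↦ Real.log ‖F j z‖) c r := fun j ↦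
    MeromorphicOn.circleIntegrable_log_norm (hFmer j _)
  have ih : CircleIntegrable (fun z ↦ Real.log ‖fun i ↦ h i z‖) c r := by
    refine ContinuousOn.circleIntegrable' (Continuous.continuousOn ?_)
    refine Continuous.log (by have := fun i ↦ (hh i).continuous; fun_prop) fun z ↦ ?_
    obtain ⟨i, hi⟩ := hz z
    exact norm_ne_zero_iff.2 (Function.ne_iff.2 ⟨i, hi⟩)
  have im : ∀ j, CircleIntegrable (m j) c r := fun j ↦
    (circleIntegrable_const _ _ _).fun_add ((circleIntegrable_const _ _ _).fun_sub (iF j))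
  have iZ : CircleIntegrable (fun z ↦ ∑ a ∈ Z, (√‖z - a‖)⁻¹) c r :=
    CircleIntegrable.fun_sum _ fun a _ ↦ (hKavg c a r hr).1
  have is : CircleIntegrable s c r := (circleIntegrable_const _ _ _).fun_add iZ
  have ims : CircleIntegrable (fun z ↦ ∑ j, m j z) c r := CircleIntegrable.fun_sum _ fun j _ ↦ im j
  have hmavg : ∀ j, circleAverage (m j) c r ≤ 2 * A := fun j ↦ by
    have h1 : circleAverage (m j) c r =
        1 + (Real.log C - circleAverage (fun z ↦ Real.log ‖F j z‖) c r) := by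
      simp only [hm]
      rw [circleAverage_fun_add (circleIntegrable_const _ _ _)
        ((circleIntegrable_const _ _ _).fun_sub (iF j)),
        circleAverage_fun_sub (circleIntegrable_const _ _ _) (iF j), circleAverage_const,
        circleAverage_const]
    have := hjF j
    have := hAj j
    linarith
  have hsavg : circleAverage s c r ≤ Q := by
    have h1 : circleAverage s c r =
        (√τ)⁻¹ + ∑ a ∈ Z, circleAverage (fun z ↦ (√‖z - a‖)⁻¹) c r := by
      simp only [hs]
      rw [circleAverage_fun_add (circleIntegrable_const _ _ _) iZ, circleAverage_const,
        circleAverage_fun_sum fun a _ ↦ (hKavg c a r hr).1]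
    have h2 : ∑ a ∈ Z, circleAverage (fun z ↦ (√‖z - a‖)⁻¹) c r ≤ Z.card * K := by
      rw [← nsmul_eq_mul]
      exact Finset.sum_le_card_nsmul _ _ _ fun a _ ↦ (hKavg c a r hr).2
    have h3 : (√τ)⁻¹ ≤ A / τ := by
      rw [inv_eq_one_div]
      refine div_le_div₀ (by linarith) hA hτ ?_
      exact Real.le_sqrt_of_sq_le (by nlinarith)
    have h4 : (Z.card : ℝ) ≤ ((2 * n + 2 : ℕ) : ℝ) * 3 * (A / τ) := by
      rw [← mul_div_assoc, le_div_iff₀ hτ]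
      linarith
    have h5 := mul_le_mul_of_nonneg_right h4 hK
    rw [h1, hQ, hκ]
    linarith
  have havg := circleAverage_mono (iΦ.fun_add ih) ((circleIntegrable_const _ _ _).fun_add
    ((is.const_fun_smul (a := N / Q)).fun_add (ims.const_fun_smul (a := (n / A : ℝ)))))
    (by rw [abs_of_pos hr0]; exact hpoint)
  rw [circleAverage_fun_add iΦ ih, circleAverage_fun_add (circleIntegrable_const _ _ _)
    ((is.const_fun_smul (a := N / Q)).fun_add (ims.const_fun_smul (a := (n / A : ℝ)))),
    circleAverage_fun_add (is.const_fun_smul (a := N / Q)) (ims.const_fun_smul (a := (n / A : ℝ))),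
    circleAverage_fun_smul, circleAverage_fun_smul, circleAverage_const,
    circleAverage_fun_sum fun j _ ↦ im j, smul_eq_mul, smul_eq_mul] at havg
  have h1 : N / Q * circleAverage s c r ≤ N := by
    have := mul_le_mul_of_nonneg_left hsavg (show 0 ≤ N / Q by positivity)
    rwa [div_mul_cancel₀ _ (by positivity)] at this
  have h2 : (n / A : ℝ) * ∑ j, circleAverage (m j) c r ≤ 2 * P := by
    have h3 : ∑ j, circleAverage (m j) c r ≤ ((2 * n + 2 : ℕ) : ℝ) * (2 * A) := by
      refine (Finset.sum_le_sum fun j _ ↦ hmavg j).trans ?_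
      simp
    have := mul_le_mul_of_nonneg_left h3 (show 0 ≤ (n / A : ℝ) by positivity)
    have h4 : (n / A : ℝ) * (((2 * n + 2 : ℕ) : ℝ) * (2 * A)) = 2 * P := by
      rw [hP]; field_simp
    linarith
  have h3 : Real.log Q = Real.log κ + (Real.log A + Real.log (1 / τ)) := by
    rw [hQ, div_eq_mul_one_div, Real.log_mul (by positivity) (by positivity),
      Real.log_mul (by positivity) (by positivity)]
  have hlA : 0 ≤ Real.log A := Real.log_nonneg hA
  have hlτ : 0 ≤ Real.log (1 / τ) := Real.log_nonneg ((one_le_div hτ).2 hτ1)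
  have h6 : d + N * Real.log Q + P * Real.log A + (N + 2 * P) ≤
      (d + N * (Real.log κ + 1) + N + 2 * P) * (1 + Real.log A + Real.log (1 / τ)) := by
    rw [h3]
    have e1 : 0 ≤ (d + N * Real.log κ + N + P) * Real.log A := by positivity
    have e2 : 0 ≤ (d + N * Real.log κ + N + 2 * P) * Real.log (1 / τ) := by positivity
    nlinarith
  linarith

/-- Borel's growth lemma, for a function that is monotone up to a bounded error. -/
lemma exists_growth_le_two_mul {T : ℝ → ℝ} (hmono : ∀ r R, 1 ≤ r → r ≤ R → T r ≤ T R + 2)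
    (hT : Tendsto T atTop atTop) (M : ℝ) :
    ∃ r, 1 ≤ r ∧ M ≤ T r ∧ T (r * (1 + 2 * (1 / T r))) ≤ 2 * T r := by
  by_contra! hcon
  obtain ⟨r₀, hr₀⟩ := eventually_atTop.1 (hT.eventually_ge_atTop (max M 1))
  set s₀ := max r₀ 1 with hs₀
  have hs₀1 : 1 ≤ s₀ := le_max_right _ _
  set s : ℕ → ℝ := fun k ↦ Nat.rec s₀ (fun _ x ↦ x * (1 + 2 * (1 / T x))) k with hs
  have hsucc : ∀ k, s (k + 1) = s k * (1 + 2 * (1 / T (s k))) := fun k ↦ rfl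
  have key : ∀ k, s₀ ≤ s k ∧ (2 : ℝ) ^ k ≤ T (s k) ∧
      s k ≤ s₀ * Real.exp (4 - 4 * (1 / 2) ^ k) := by
    intro k
    induction k with
    | zero =>
      exact ⟨le_rfl,
        by simpa [hs] using (le_max_right M 1).trans (hr₀ s₀ (le_max_left _ _)), by simp [hs]⟩
    | succ k ih =>
      obtain ⟨h1, h2, h3⟩ := ih
      have hpow : (0 : ℝ) < 2 ^ k := by positivity
      have hT0 : 0 < T (s k) := hpow.trans_le h2
      have h4 := hcon (s k) (hs₀1.trans h1)
        ((le_max_left M 1).trans (hr₀ _ ((le_max_left _ _).trans h1)))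
      have hsk : 0 < s k := by linarith
      rw [hsucc]
      refine ⟨?_, by rw [pow_succ]; linarith, ?_⟩
      · have : 0 ≤ s k * (2 * (1 / T (s k))) := by positivity
        linarith
      · have h5 : 1 / T (s k) ≤ (1 / 2) ^ k := by
          rw [one_div_pow]
          exact one_div_le_one_div_of_le hpow h2
        have h6 : 1 + 2 * (1 / T (s k)) ≤ Real.exp (2 * (1 / 2) ^ k) := by
          have := Real.add_one_le_exp (2 * (1 / 2 : ℝ) ^ k)
          linarith
        have h7 : (4 : ℝ) - 4 * (1 / 2) ^ (k + 1) = (4 - 4 * (1 / 2) ^ k) + 2 * (1 / 2) ^ k := by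
          rw [pow_succ]; ring
        rw [h7, Real.exp_add, ← mul_assoc]
        exact mul_le_mul h3 h6 (by positivity) (by positivity)
  obtain ⟨k, hk⟩ := pow_unbounded_of_one_lt (T (s₀ * Real.exp 4) + 2) one_lt_two
  obtain ⟨h1, h2, h3⟩ := key k
  have h4 : s k ≤ s₀ * Real.exp 4 := by
    refine h3.trans ?_
    gcongr
    linarith [show (0 : ℝ) ≤ 4 * (1 / 2) ^ k by positivity]
  have := hmono _ _ (hs₀1.trans h1) h4
  linarith

/-- A function tending to infinity cannot satisfy a logarithmic self-bound. -/
lemma false_of_growth_le_log {T : ℝ → ℝ} (hmono : ∀ r R, 1 ≤ r → r ≤ R → T r ≤ T R + 2)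
    (hT : Tendsto T atTop atTop) {C C' : ℝ} (hC : 0 ≤ C)
    (hmain : ∀ r τ, 1 ≤ r → 0 < τ → τ ≤ 1 → 1 ≤ T (r * (1 + 2 * τ)) + C' →
      T r ≤ C * (1 + Real.log (T (r * (1 + 2 * τ)) + C') + Real.log (1 / τ))) : False := by
  have hlog : ∀ᶠ x : ℝ in atTop, C * (1 + Real.log (3 * x) + Real.log x) < x := by
    have h1 : ∀ᶠ x : ℝ in atTop, ‖Real.log x‖ ≤ 1 / (4 * (C + 1)) * ‖x‖ :=
      Real.isLittleO_log_id_atTop.bound (by positivity)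
    filter_upwards [h1, eventually_ge_atTop 1,
      eventually_gt_atTop (2 * (C * (1 + Real.log 3)))] with x hx hx1 hx2
    have hx0 : 0 < x := by linarith
    rw [Real.norm_of_nonneg (Real.log_nonneg hx1), Real.norm_of_nonneg hx0.le] at hx
    rw [Real.log_mul (by norm_num) hx0.ne']
    have h3 : 2 * C * Real.log x ≤ x / 2 := by
      calc 2 * C * Real.log x ≤ 2 * C * (1 / (4 * (C + 1)) * x) := by gcongr
        _ = C / (C + 1) * (x / 2) := by field_simp; ring
        _ ≤ 1 * (x / 2) := by gcongr; rw [div_le_one (by positivity)]; linarith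
        _ = _ := one_mul _
    linarith
  obtain ⟨M, hM⟩ := eventually_atTop.1 hlog
  obtain ⟨r, hr, hMr, h2⟩ := exists_growth_le_two_mul hmono hT (max M (max 1 (|C'| + 3)))
  have h1 : 1 ≤ T r := (le_max_left _ _).trans ((le_max_right _ _).trans hMr)
  have h3 : |C'| + 3 ≤ T r := (le_max_right _ _).trans ((le_max_right _ _).trans hMr)
  have hτ : 0 < 1 / T r := by positivity
  have h4 := hmono r (r * (1 + 2 * (1 / T r))) hr
    (le_mul_of_one_le_right (by linarith) (by linarith))
  have h5 := neg_abs_le C'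
  have h6 := le_abs_self C'
  have h7 := hmain r (1 / T r) hr hτ ((div_le_one (by linarith)).2 h1) (by linarith)
  rw [one_div_one_div] at h7
  have h8 := hM (T r) ((le_max_left _ _).trans hMr)
  have h9 : Real.log (T (r * (1 + 2 * (1 / T r))) + C') ≤ Real.log (3 * T r) :=
    Real.log_le_log (by linarith) (by linarith)
  nlinarith

/-- The Cartan characteristic of a map, with respect to the maximum norm and the centre `c`. -/
def cartanCharacteristic {n : ℕ} (f : Fin (n + 1) → ℂ → ℂ) (c : ℂ) (r : ℝ) : ℝ :=
  circleAverage (fun z ↦ Real.log ‖fun i ↦ f i z‖) c r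

lemma continuous_log_norm_of_no_common_zeros {n : ℕ} {f : Fin (n + 1) → ℂ → ℂ}
    (hf : ∀ i, Differentiable ℂ (f i)) (hz : ∀ z, ∃ i, f i z ≠ 0) :
    Continuous fun z ↦ Real.log ‖fun i ↦ f i z‖ := by
  refine Continuous.log (by have := fun i ↦ (hf i).continuous; fun_prop) fun z ↦ ?_
  obtain ⟨i, hi⟩ := hz z
  exact norm_ne_zero_iff.2 (Function.ne_iff.2 ⟨i, hi⟩)

lemma norm_exp_neg_mul {n : ℕ} (f : Fin (n + 1) → ℂ → ℂ) (q : ℂ → ℂ) (z : ℂ) :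
    ‖fun i ↦ Complex.exp (-q z) * f i z‖ = Real.exp (-(q z).re) * ‖fun i ↦ f i z‖ := by
  rw [← Complex.neg_re, ← Complex.norm_exp, ← norm_smul]
  rfl

/-- A reduced representation can be normalised on a disc by a nowhere vanishing factor. -/
lemma exists_normalisation {n : ℕ} {f : Fin (n + 1) → ℂ → ℂ}
    (hf : ∀ i, Differentiable ℂ (f i)) (hz : ∀ z, ∃ i, f i z ≠ 0) (c : ℂ) {R : ℝ} (hR : 0 < R) :
    ∃ q : ℂ → ℂ, Differentiable ℂ q ∧
      (∀ z ∈ closedBall c R, ‖fun i ↦ Complex.exp (-q z) * f i z‖ ≤ Real.exp 1) ∧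
      |(q c).re - cartanCharacteristic f c R| ≤ 1 := by
  have hu := continuous_log_norm_of_no_common_zeros hf hz
  obtain ⟨q, hq, hqu⟩ := exists_entire_re_approx hu c hR
  have hpos : ∀ z, 0 < ‖fun i ↦ f i z‖ := fun z ↦ by
    obtain ⟨i, hi⟩ := hz z
    exact norm_pos_iff.2 (Function.ne_iff.2 ⟨i, hi⟩)
  refine ⟨q, hq, fun z hzR ↦ ?_, ?_⟩
  · have hd : Differentiable ℂ fun z ↦ (fun i ↦ Complex.exp (-q z) * f i z) :=
      differentiable_pi.2 fun i ↦ hq.neg.cexp.mul (hf i)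
    refine Complex.norm_le_of_forall_mem_frontier_norm_le (U := ball c R) isBounded_ball
      hd.diffContOnCl (fun w hw ↦ ?_) (by rwa [closure_ball c hR.ne'])
    rw [frontier_ball c hR.ne'] at hw
    have h1 := abs_le.1 (hqu w hw)
    rw [norm_exp_neg_mul, ← Real.exp_log (hpos w), ← Real.exp_add, Real.exp_le_exp]
    linarith
  · have iq : CircleIntegrable (fun z ↦ (q z).re) c R :=
      (Complex.continuous_re.comp hq.continuous).continuousOn.circleIntegrable'
    have iu : CircleIntegrable (fun z ↦ Real.log ‖fun i ↦ f i z‖) c R :=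
      hu.continuousOn.circleIntegrable'
    have iR : ∀ a : ℝ, CircleIntegrable (fun _ ↦ a) c R := fun a ↦ circleIntegrable_const _ _ _
    rw [← circleAverage_re_of_differentiable hq c R, cartanCharacteristic,
      ← circleAverage_fun_sub iq iu, abs_le]
    constructor
    · rw [← circleAverage_const (-1 : ℝ) c R]
      refine circleAverage_mono (iR _) (iq.fun_sub iu) fun w hw ↦ ?_
      rw [abs_of_pos hR] at hw
      exact (abs_le.1 (hqu w hw)).1
    · rw [← circleAverage_const (1 : ℝ) c R]
      refine circleAverage_mono (iq.fun_sub iu) (iR _) fun w hw ↦ ?_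
      rw [abs_of_pos hR] at hw
      exact (abs_le.1 (hqu w hw)).2

lemma cartanCharacteristic_le_add_two {n : ℕ} {f : Fin (n + 1) → ℂ → ℂ}
    (hf : ∀ i, Differentiable ℂ (f i)) (hz : ∀ z, ∃ i, f i z ≠ 0) (c : ℂ) {r R : ℝ} (hr : 0 < r)
    (hrR : r ≤ R) : cartanCharacteristic f c r ≤ cartanCharacteristic f c R + 2 := by
  obtain ⟨q, hq, hb, hqc⟩ := exists_normalisation hf hz c (hr.trans_le hrR)
  have h1 : cartanCharacteristic f c r ≤ circleAverage (fun z ↦ 1 + (q z).re) c r := by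
    refine circleAverage_mono
      (continuous_log_norm_of_no_common_zeros hf hz).continuousOn.circleIntegrable'
      (Continuous.continuousOn (by have := hq.continuous; fun_prop)).circleIntegrable'
      fun w hw ↦ ?_
    rw [abs_of_pos hr] at hw
    have h2 := hb w (closedBall_subset_closedBall hrR (sphere_subset_closedBall hw))
    have h3 : 0 < ‖fun i ↦ f i w‖ := by
      obtain ⟨i, hi⟩ := hz w
      exact norm_pos_iff.2 (Function.ne_iff.2 ⟨i, hi⟩)
    rw [norm_exp_neg_mul, ← Real.exp_log h3, ← Real.exp_add, Real.exp_le_exp] at h2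
    linarith
  have iq : CircleIntegrable (fun z ↦ (q z).re) c r :=
    (Complex.continuous_re.comp hq.continuous).continuousOn.circleIntegrable'
  rw [circleAverage_fun_add (circleIntegrable_const _ _ _) iq, circleAverage_const,
    circleAverage_re_of_differentiable hq c r] at h1
  linarith [(abs_le.1 hqc).2]

lemma tendsto_cartanCharacteristic {n : ℕ} (hn : 1 ≤ n) {f : Fin (n + 1) → ℂ → ℂ}
    (hf : ∀ i, Differentiable ℂ (f i)) (hz : ∀ z, ∃ i, f i z ≠ 0) {c : ℂ}
    (hc : (wronskianMatrix f c).det ≠ 0) :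
    Tendsto (cartanCharacteristic f c) atTop atTop := by
  set E : ℝ := n.factorial * Real.exp 1 with hE
  set K : ℝ := (n + 1).factorial * E ^ (n + 1) with hK
  have hE0 : 0 < E := by positivity
  have key : ∀ R, 1 ≤ R →
      (Real.log R + (Real.log ‖(wronskianMatrix f c).det‖ - Real.log K)) / (n + 1) - 1 ≤
        cartanCharacteristic f c R := by
    intro R hR
    have hR0 : 0 < R := by linarith
    obtain ⟨q, hq, hb, hqc⟩ := exists_normalisation hf hz c hR0
    have hh : ∀ i, Differentiable ℂ fun w ↦ Complex.exp (-q w) * f i w := fun i ↦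
      hq.neg.cexp.mul (hf i)
    have hcauchy : ∀ i k : Fin (n + 1),
        ‖(wronskianMatrix (fun i w ↦ Complex.exp (-q w) * f i w) c).transpose i k‖ ≤
          E * R⁻¹ ^ (k : ℕ) := by
      intro i k
      have h1 := Complex.norm_iteratedDeriv_le_of_forall_mem_sphere_norm_le (k : ℕ) hR0
        (hh i).diffContOnCl (C := Real.exp 1) fun z hzR ↦
          (norm_le_pi_norm (fun i ↦ Complex.exp (-q z) * f i z) i).trans
            (hb z (sphere_subset_closedBall hzR))
      refine h1.trans ?_
      rw [div_eq_mul_inv, ← inv_pow, hE]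
      have : ((k : ℕ).factorial : ℝ) ≤ n.factorial := by
        exact_mod_cast Nat.factorial_le (Nat.lt_succ_iff.1 k.2)
      gcongr
    have h1 := Matrix.norm_det_le_prod hcauchy
    rw [Matrix.det_transpose, det_wronskianMatrix_mul hf (h := fun w ↦ Complex.exp (-q w))
      hq.neg.cexp, Finset.prod_mul_distrib, Finset.prod_const, Finset.card_univ, Fintype.card_fin,
      Finset.prod_pow_eq_pow_sum, norm_mul, norm_pow, Complex.norm_exp, ← mul_assoc] at h1
    have h2 : R⁻¹ ^ ∑ k : Fin (n + 1), (k : ℕ) ≤ R⁻¹ := by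
      refine pow_le_of_le_one (by positivity) (inv_le_one_of_one_le₀ hR) ?_
      have := Finset.single_le_sum (f := fun k : Fin (n + 1) ↦ (k : ℕ)) (fun _ _ ↦ Nat.zero_le _)
        (Finset.mem_univ (Fin.last n))
      simp only [Fin.val_last] at this
      omega
    have h3 := h1.trans (mul_le_mul_of_nonneg_left h2 (by positivity))
    have h4 := Real.log_le_log (by positivity) h3
    rw [Real.log_mul (by positivity) (norm_ne_zero_iff.2 hc), Real.log_pow, Real.log_exp,
      Real.log_mul (by positivity) (by positivity), Real.log_inv, Complex.neg_re] at h4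
    have h5 := (abs_le.1 hqc).2
    rw [sub_le_iff_le_add, div_le_iff₀ (by positivity)]
    push_cast at h4
    nlinarith [show (0 : ℝ) < n + 1 by positivity]
  refine tendsto_atTop_mono' atTop ((eventually_ge_atTop 1).mono key) ?_
  exact tendsto_atTop_add_const_right _ _
    ((tendsto_atTop_add_const_right _ _ Real.tendsto_log_atTop).atTop_div_const (by positivity))

lemma lform_mul {n : ℕ} (a : Fin (n + 1) → ℂ) (f : Fin (n + 1) → ℂ → ℂ) (e : ℂ → ℂ) (z : ℂ) :
    lform a (fun i w ↦ e w * f i w) z = e z * lform a f z := by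
  simp only [lform, Finset.mul_sum]
  exact Finset.sum_congr rfl fun i _ ↦ by ring

lemma wronskianQuotient_exp_neg_mul {n : ℕ} (H : Fin (2 * n + 2) → Fin (n + 1) → ℂ)
    (L : Fin (n + 1) → ℂ) {f : Fin (n + 1) → ℂ → ℂ} (hf : ∀ i, Differentiable ℂ (f i)) {q : ℂ → ℂ}
    (hq : Differentiable ℂ q) (z : ℂ) :
    wronskianQuotient H L (fun i w ↦ Complex.exp (-q w) * f i w) z =
      Complex.exp (q z) * wronskianQuotient H L f z := by
  have hE : Complex.exp (-q z) ≠ 0 := Complex.exp_ne_zero _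
  have hinv : Complex.exp (q z) = (Complex.exp (-q z))⁻¹ := by rw [Complex.exp_neg, inv_inv]
  simp only [wronskianQuotient]
  rw [det_wronskianMatrix_mul hf (h := fun w ↦ Complex.exp (-q w)) hq.neg.cexp]
  simp only [lform_mul _ _ fun w ↦ Complex.exp (-q w)]
  rw [Finset.prod_mul_distrib, Finset.prod_const, Finset.card_univ, Fintype.card_fin, hinv,
    mul_pow]
  have hpow : Complex.exp (-q z) ^ (2 * n + 2) =
      Complex.exp (-q z) ^ (n + 1) * Complex.exp (-q z) ^ n * Complex.exp (-q z) := by ring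
  rw [hpow]
  field_simp

lemma eventually_ne_zero_of_entire {F : ℂ → ℂ} (hF : Differentiable ℂ F) {w : ℂ} (hw : F w ≠ 0)
    (z : ℂ) : ∀ᶠ x in 𝓝[≠] z, F x ≠ 0 := by
  by_contra h
  refine hw (AnalyticOnNhd.eqOn_zero_of_preconnected_of_frequently_eq_zero
    (fun x _ ↦ hF.analyticAt x) isPreconnected_univ (Set.mem_univ z)
    ((not_eventually.1 h).mono fun x hx ↦ not_not.1 hx) (Set.mem_univ w))

lemma exists_lform_ne_zero {n : ℕ} {f : Fin (n + 1) → ℂ → ℂ} (hlin : LinearIndependent ℂ f)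
    {a : Fin (n + 1) → ℂ} (ha : a ≠ 0) : ∃ z, lform a f z ≠ 0 := by
  by_contra! h
  refine ha (funext (Fintype.linearIndependent_iff.1 hlin a (funext fun z ↦ ?_)))
  simpa [lform] using h z

/-- Second main theorem argument: a linear form vanishing on the zeros of `2n + 2` hyperplanes in
general position, with disjoint preimages, vanishes identically. -/
theorem eq_zero_of_lform_eq_zero_on_preimages {n : ℕ} (hn : 1 ≤ n) {f : Fin (n + 1) → ℂ → ℂ}
    (hf : ∀ i, Differentiable ℂ (f i)) (hz : ∀ z, ∃ i, f i z ≠ 0) (hlin : LinearIndependent ℂ f)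
    {H : Fin (2 * n + 2) → Fin (n + 1) → ℂ} (hH : GenPos n (2 * n + 2) H)
    (hdisj : ∀ i j, i ≠ j → ∀ z, lform (H i) f z = 0 → lform (H j) f z ≠ 0)
    {L : Fin (n + 1) → ℂ} (hL : ∀ j z, lform (H j) f z = 0 → lform L f z = 0) : L = 0 := by
  by_contra hL0
  obtain ⟨c, hc⟩ : ∃ c, wronskianQuotient H L f c ≠ 0 := by
    have hH0 : ∀ j, H j ≠ 0 := by
      intro j
      obtain ⟨s, hjs, -, hs⟩ := Finset.exists_subsuperset_card_eq (Finset.subset_univ {j})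
        (n := n + 1) (by simp) (by rw [Finset.card_univ, Fintype.card_fin]; omega)
      exact (hH s hs).ne_zero ⟨j, Finset.singleton_subset_iff.1 hjs⟩
    obtain ⟨w, hw⟩ := exists_det_wronskianMatrix_ne_zero hf hlin
    obtain ⟨w', hw'⟩ := exists_lform_ne_zero hlin hL0
    have h1 := eventually_ne_zero_of_entire
      (Differentiable.matrix_det (differentiable_wronskianMatrix hf)) hw 0
    have h2 := eventually_ne_zero_of_entire (differentiable_lform hf L) hw' 0
    have h3 : ∀ᶠ z in 𝓝[≠] (0 : ℂ), ∀ j, lform (H j) f z ≠ 0 := eventually_all.2 fun j ↦ by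
      obtain ⟨w, hw⟩ := exists_lform_ne_zero hlin (hH0 j)
      exact eventually_ne_zero_of_entire (differentiable_lform hf (H j)) hw 0
    obtain ⟨c, hc1, hc2, hc3⟩ := (h1.and (h2.and h3)).exists
    exact ⟨c, div_ne_zero (mul_ne_zero hc1 (pow_ne_zero _ hc2))
      (Finset.prod_ne_zero_iff.2 fun j _ ↦ hc3 j)⟩
  have hWc : (wronskianMatrix f c).det ≠ 0 := fun h ↦ hc (by simp [wronskianQuotient, h])
  have hFc : ∀ j, lform (H j) f c ≠ 0 := fun j hj ↦ hc (by
    rw [wronskianQuotient, Finset.prod_eq_zero (Finset.mem_univ j) hj, div_zero])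
  obtain ⟨B, D, hD, key⟩ := exists_log_wronskianQuotient_add_circleAverage_le hn hH L
  set T := cartanCharacteristic f c with hT
  set C' : ℝ := 1 + ∑ j, |B - Real.log ‖lform (H j) f c‖| with hC'
  set D' : ℝ := D + |Real.log ‖wronskianQuotient H L f c‖| with hD'
  refine false_of_growth_le_log (T := T) (C := D') (C' := C')
    (fun r R hr hrR ↦ cartanCharacteristic_le_add_two hf hz c (by linarith) hrR)
    (tendsto_cartanCharacteristic hn hf hz hWc) (by positivity) ?_
  intro r τ hr hτ hτ1 hA
  have hr0 : 0 < r := by linarith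
  obtain ⟨q, hq, hb, hqc⟩ := exists_normalisation hf hz c (R := r * (1 + 2 * τ)) (by positivity)
  have hqc' := abs_le.1 hqc
  have hE : ∀ w, Complex.exp (-q w) ≠ 0 := fun w ↦ Complex.exp_ne_zero _
  have hlf : ∀ (a : Fin (n + 1) → ℂ) (w : ℂ),
      lform a (fun i w ↦ Complex.exp (-q w) * f i w) w = 0 ↔ lform a f w = 0 := fun a w ↦ by
    rw [lform_mul a f fun w ↦ Complex.exp (-q w), mul_eq_zero, or_iff_right (hE w)]
  have hΦ := wronskianQuotient_exp_neg_mul H L hf hq c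
  have h1 := key (fun i w ↦ Complex.exp (-q w) * f i w) c r τ (T (r * (1 + 2 * τ)) + C')
    (fun i ↦ hq.neg.cexp.mul (hf i))
    (fun w ↦ (hz w).imp fun i hi ↦ mul_ne_zero (hE w) hi)
    (fun i j hij w hw ↦ (hlf _ _).not.2 (hdisj i j hij w ((hlf _ _).1 hw)))
    (fun j w hw ↦ (hlf _ _).2 (hL j w ((hlf _ _).1 hw)))
    (by rw [hΦ]; exact mul_ne_zero (Complex.exp_ne_zero _) hc) hr hτ hτ1 hb hA ?_
  · have hu := continuous_log_norm_of_no_common_zeros hf hz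
    have hpos : ∀ w, 0 < ‖fun i ↦ f i w‖ := fun w ↦ by
      obtain ⟨i, hi⟩ := hz w
      exact norm_pos_iff.2 (Function.ne_iff.2 ⟨i, hi⟩)
    have h2 : circleAverage (fun w ↦ Real.log ‖fun i ↦ Complex.exp (-q w) * f i w‖) c r =
        T r - (q c).re := by
      have h3 : ∀ w, Real.log ‖fun i ↦ Complex.exp (-q w) * f i w‖ =
          Real.log ‖fun i ↦ f i w‖ - (q w).re := fun w ↦ by
        rw [norm_exp_neg_mul, Real.log_mul (by positivity) (hpos w).ne', Real.log_exp]
        ring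
      have iq : CircleIntegrable (fun z ↦ (q z).re) c r :=
        (Complex.continuous_re.comp hq.continuous).continuousOn.circleIntegrable'
      simp only [h3]
      rw [circleAverage_fun_sub hu.continuousOn.circleIntegrable' iq,
        circleAverage_re_of_differentiable hq c r]
      rfl
    rw [h2, hΦ, norm_mul, Real.log_mul (by simp) (norm_ne_zero_iff.2 hc), Complex.norm_exp,
      Real.log_exp] at h1
    have h4 := neg_abs_le (Real.log ‖wronskianQuotient H L f c‖)
    have h5 : 0 ≤ Real.log (T (r * (1 + 2 * τ)) + C') + Real.log (1 / τ) :=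
      add_nonneg (Real.log_nonneg hA) (Real.log_nonneg ((one_le_div hτ).2 hτ1))
    have h6 := mul_nonneg (abs_nonneg (Real.log ‖wronskianQuotient H L f c‖)) h5
    rw [hD']
    linarith
  · intro j
    have h2 := Finset.single_le_sum (f := fun j ↦ |B - Real.log ‖lform (H j) f c‖|)
      (fun _ _ ↦ abs_nonneg _) (Finset.mem_univ j)
    have h3 := le_abs_self (B - Real.log ‖lform (H j) f c‖)
    rw [lform_mul (H j) f fun w ↦ Complex.exp (-q w), norm_mul, Real.log_mul (by simp)
      (norm_ne_zero_iff.2 (hFc j)), Complex.norm_exp, Real.log_exp, Complex.neg_re]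
    linarith

lemma lform_vecMul {n : ℕ} (x : Fin (n + 1) → ℂ) (M : Matrix (Fin (n + 1)) (Fin (n + 1)) ℂ)
    (f : Fin (n + 1) → ℂ → ℂ) (z : ℂ) :
    lform (Matrix.vecMul x M) f z = ∑ r, x r * lform (M r) f z :=
  (Matrix.dotProduct_mulVec x M fun i ↦ f i z).symm

lemma lform_sub {n : ℕ} (a b : Fin (n + 1) → ℂ) (f : Fin (n + 1) → ℂ → ℂ) (z : ℂ) :
    lform (a - b) f z = lform a f z - lform b f z := by
  simp [lform, sub_mul]

end

/-- **Intermediate claim in the proof of the theorem of Section 3 (one-variable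
case).** Under conditions (a)–(d), the projective linear transformation `ℒ`
induced by `C = A⁻¹B`, where `A` and `B` have as rows the coefficient vectors
of `H₁, …, H_{n+1}` and `G₁, …, G_{n+1}` respectively, satisfies
`ℒ(G_i) = H_i` for every `i = 1, …, 2n+2`; that is, the coefficient vector
`G_i · C⁻¹` is a nonzero scalar multiple of that of `H_i`. -/
theorem section3_transformation
    (n : ℕ) (hn : 1 ≤ n)
    (f g : Fin (n + 1) → ℂ → ℂ)
    (hf : ReducedRepr n f) (hg : ReducedRepr n g)
    (hlin : LinearIndependent ℂ f)
    (H G : Fin (2 * n + 2) → Fin (n + 1) → ℂ)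
    (hGPH : GenPos n (2 * n + 2) H) (hGPG : GenPos n (2 * n + 2) G)
    (ha : ∀ i j : Fin (2 * n + 2), i < j →
      ∀ z : ℂ, ¬(lform (H i) f z = 0 ∧ lform (H j) f z = 0))
    (hb : ∀ i : Fin (2 * n + 2), (i : ℕ) < 2 * n + 1 →
      ∀ z : ℂ, lform (H i) f z = 0 ↔ lform (G i) g z = 0)
    (hc : ∀ z : ℂ, min (vord (lform (H ⟨2 * n + 1, by omega⟩) f) z) (n + 1)
      = min (vord (lform (G ⟨2 * n + 1, by omega⟩) g) z) (n + 1))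
    (hd : ∀ v j : Fin (2 * n + 2), ∀ z : ℂ,
      (∃ i : Fin (2 * n + 2), lform (H i) f z = 0) → lform (H j) f z ≠ 0 →
      lform (H v) f z * lform (G j) g z = lform (G v) g z * lform (H j) f z)
    (A B : Matrix (Fin (n + 1)) (Fin (n + 1)) ℂ)
    (hA : ∀ r c : Fin (n + 1), A r c = H (Fin.castLE (by omega) r) c)
    (hB : ∀ r c : Fin (n + 1), B r c = G (Fin.castLE (by omega) r) c) :
    ∀ i : Fin (2 * n + 2), ∃ lam : ℂ, lam ≠ 0 ∧
      Matrix.vecMul (G i) (A⁻¹ * B)⁻¹ = lam • H i := by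
  have hAf : A = Matrix.of (H ∘ Fin.castLE (show n + 1 ≤ 2 * n + 2 by omega)) := Matrix.ext hA
  have hBf : B = Matrix.of (G ∘ Fin.castLE (show n + 1 ≤ 2 * n + 2 by omega)) := Matrix.ext hB
  have hAdet : IsUnit A.det := isUnit_iff_ne_zero.2 <| by
    rw [hAf]; exact hGPH.det_ne_zero (Fin.castLE_injective _)
  have hBdet : IsUnit B.det := isUnit_iff_ne_zero.2 <| by
    rw [hBf]; exact hGPG.det_ne_zero (Fin.castLE_injective _)
  have hdisj : ∀ i j, i ≠ j → ∀ z, lform (H i) f z = 0 → lform (H j) f z ≠ 0 := by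
    intro i j hij z hi hj
    rcases hij.lt_or_gt with h | h
    · exact ha i j h z ⟨hi, hj⟩
    · exact ha j i h z ⟨hj, hi⟩
  have hratio : ∀ i z, lform (H i) f z = 0 →
      ∃ t : ℂ, ∀ v, lform (H v) f z = t * lform (G v) g z := by
    intro i z hi
    obtain ⟨k, hk⟩ := exists_ne i
    have hFk := hdisj i k hk.symm z hi
    have hv := fun v ↦ hd v k z ⟨i, hi⟩ hFk
    have hKk : lform (G k) g z ≠ 0 := by
      intro h0
      have hK : ∀ v, lform (G v) g z = 0 := fun v ↦ by
        have := hv v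
        rw [h0, mul_zero] at this
        exact (mul_eq_zero.1 this.symm).resolve_right hFk
      obtain ⟨i, hi⟩ := hg.2 z
      refine hi (congrFun (Matrix.eq_zero_of_mulVec_eq_zero hBdet.ne_zero
        (v := fun i ↦ g i z) (funext fun r ↦ ?_)) i)
      rw [hBf]
      exact hK _
    refine ⟨lform (H k) f z / lform (G k) g z, fun v ↦ ?_⟩
    rw [div_mul_eq_mul_div, eq_div_iff hKk, hv v, mul_comm]
  intro j
  have hL : H j - Matrix.vecMul (Matrix.vecMul (G j) B⁻¹) A = 0 := by
    refine eq_zero_of_lform_eq_zero_on_preimages hn hf.1 hf.2 hlin hGPH hdisj fun i z hi ↦ ?_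
    obtain ⟨t, ht⟩ := hratio i z hi
    have hGj : G j = Matrix.vecMul (Matrix.vecMul (G j) B⁻¹) B := by
      rw [Matrix.vecMul_vecMul, Matrix.nonsing_inv_mul _ hBdet, Matrix.vecMul_one]
    have hrow : ∀ r, lform (A r) f z = t * lform (B r) g z := fun r ↦ by
      rw [hAf, hBf]; exact ht _
    have hKj : lform (G j) g z = ∑ r, Matrix.vecMul (G j) B⁻¹ r * lform (B r) g z := by
      rw [← lform_vecMul, ← hGj]
    rw [lform_sub, lform_vecMul, ht j, hKj, Finset.mul_sum, sub_eq_zero]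
    refine Finset.sum_congr rfl fun r _ ↦ ?_
    rw [hrow]
    ring
  refine ⟨1, one_ne_zero, ?_⟩
  rw [Matrix.mul_inv_rev, Matrix.nonsing_inv_nonsing_inv _ hAdet, ← Matrix.vecMul_vecMul, one_smul,
    ← sub_eq_zero.1 hL]
end
end
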